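/- arXiv:2502.04662 — 4 statements merged into one kernel-verified Lean document; each statement's English description precedes it below -/
import Mathlib

section
/- Under the Huber-contaminated noiseless reward model, if the step sizes of TD(0) satisfy ∑_{t=0}^∞ α_t = ∞ and ∑_{t=0}^∞ α_t² < ∞, then the TD(0) iterates θ_t converge with probability 1 to θ̃* = (1−ε)θ* + ε(−Ā⁻¹ΦᵀDC), where θ* = −Ā⁻¹ΦᵀDR. Moreover, for every point w ∈ ℝ^K there exists a corrupted reward vector C_w ∈ ℝ^m such that the corresponding limit θ̃* equals w. -/
open Matrix MeasureTheory Filter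

/-- A nonnegative sequence contracting at rate `1 - κ α_t` up to errors `o(α_t)` tends to zero
when `∑ α_t = ∞`. -/
lemma tendsto_zero_of_le_one_sub_mul_add {a α : ℕ → ℝ} {κ : ℝ} (hκ : 0 < κ)
    (ha : ∀ t, 0 ≤ a t) (hα0 : Tendsto α atTop (nhds 0))
    (hαdiv : Tendsto (fun n => ∑ t ∈ Finset.range n, α t) atTop atTop)
    (h : ∀ η > 0, ∀ᶠ t in atTop, a (t + 1) ≤ (1 - κ * α t) * a t + α t * η) :
    Tendsto a atTop (nhds 0) := by
  rw [Metric.tendsto_atTop]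
  intro r hr
  have hη : 0 < κ * r / 2 := by positivity
  have hsmall : ∀ᶠ t in atTop, α t < 1 / κ := hα0.eventually_lt_const (by positivity)
  obtain ⟨t₀, ht₀⟩ := eventually_atTop.1 ((h _ hη).and hsmall)
  set G : ℕ → ℝ := fun n => ∑ t ∈ Finset.range n, α t with hG
  have key : ∀ t ≥ t₀, a t - r / 2 ≤ Real.exp (-(κ * (G t - G t₀))) * a t₀ := by
    intro t ht
    induction t, ht using Nat.le_induction with
    | base => simp; linarith
    | succ t ht ih =>
      obtain ⟨h1, h2⟩ := ht₀ t ht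
      have h3 : κ * α t < 1 := by rwa [lt_div_iff₀ hκ, mul_comm] at h2
      have h4 : 1 - κ * α t ≤ Real.exp (-(κ * α t)) := by
        have := Real.add_one_le_exp (-(κ * α t)); linarith
      have h5 : G (t + 1) = G t + α t := Finset.sum_range_succ _ _
      have h6 : Real.exp (-(κ * (G (t + 1) - G t₀)))
          = Real.exp (-(κ * α t)) * Real.exp (-(κ * (G t - G t₀))) := by
        rw [← Real.exp_add, h5]; ring_nf
      rw [h6]
      calc a (t + 1) - r / 2 ≤ (1 - κ * α t) * (a t - r / 2) := by linarith
        _ ≤ (1 - κ * α t) * (Real.exp (-(κ * (G t - G t₀))) * a t₀) := by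
          gcongr
        _ ≤ Real.exp (-(κ * α t)) * (Real.exp (-(κ * (G t - G t₀))) * a t₀) := by
          gcongr
          exact mul_nonneg (Real.exp_pos _).le (ha _)
        _ = _ := by ring
  have hlim : Tendsto (fun t => Real.exp (-(κ * (G t - G t₀))) * a t₀) atTop (nhds 0) := by
    have h1 : Tendsto (fun t => κ * (G t - G t₀)) atTop atTop :=
      (tendsto_atTop_add_const_right _ (-G t₀) hαdiv).const_mul_atTop hκ
    have h2 := (Real.tendsto_exp_neg_atTop_nhds_zero.comp h1).mul_const (a t₀)
    simpa [Function.comp_def] using h2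
  obtain ⟨t₁, ht₁⟩ := eventually_atTop.1 (hlim.eventually_lt_const (half_pos hr))
  refine ⟨max t₀ t₁, fun t ht => ?_⟩
  have h1 := key t (le_trans (le_max_left _ _) ht)
  have h2 := ht₁ t (le_trans (le_max_right _ _) ht)
  rw [Real.dist_eq, sub_zero, abs_of_nonneg (ha t)]
  linarith

section LinearRecursion

variable {E : Type*} [NormedAddCommGroup E] [InnerProductSpace ℝ E]

/-- A linear map with negative definite quadratic form is uniformly so in finite dimension. -/
lemma exists_inner_le_neg_mul_sq_of_inner_neg [FiniteDimensional ℝ E] (L : E →L[ℝ] E)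
    (hL : ∀ x, x ≠ 0 → inner ℝ x (L x) < 0) :
    ∃ c > 0, ∀ x, inner ℝ x (L x) ≤ -c * ‖x‖ ^ 2 := by
  rcases (Metric.sphere (0 : E) 1).eq_empty_or_nonempty with hE | hE
  · have hz : ∀ x : E, x = 0 := by
      intro x
      by_contra hx
      have : ‖x‖⁻¹ • x ∈ Metric.sphere (0 : E) 1 := by
        simp [norm_smul, norm_ne_zero_iff.2 hx]
      simp [hE] at this
    exact ⟨1, one_pos, fun x => by simp [hz x]⟩
  · obtain ⟨z, hz, hmax⟩ := (isCompact_sphere (0 : E) 1).exists_isMaxOn hE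
      (f := fun x => inner ℝ x (L x)) (by fun_prop)
    have hz0 : z ≠ 0 := by
      rintro rfl
      simp at hz
    refine ⟨-inner ℝ z (L z), by linarith [hL z hz0], fun x => ?_⟩
    by_cases hx : x = 0
    · simp [hx]
    have hx' : ‖x‖ ≠ 0 := norm_ne_zero_iff.2 hx
    have hmem : ‖x‖⁻¹ • x ∈ Metric.sphere (0 : E) 1 := by
      simp [norm_smul, hx']
    have h1 := hmax hmem
    simp only [Set.mem_ofPred_eq, map_smul, real_inner_smul_left, real_inner_smul_right] at h1
    rw [neg_neg]
    have h2 := mul_le_mul_of_nonneg_right h1 (sq_nonneg ‖x‖)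
    field_simp at h2
    linarith

/-- One explicit Euler step of a strictly dissipative linear field is a contraction. -/
lemma norm_add_smul_le_of_inner_le {L : E →L[ℝ] E} {c : ℝ}
    (hL : ∀ x, inner ℝ x (L x) ≤ -c * ‖x‖ ^ 2) {a : ℝ} (ha : 0 ≤ a)
    (ha1 : a * ‖L‖ ^ 2 ≤ c) (ha2 : a * c ≤ 1) (x : E) :
    ‖x + a • L x‖ ≤ (1 - c / 2 * a) * ‖x‖ := by
  have h0 : 0 ≤ 1 - c / 2 * a := by nlinarith
  apply le_of_sq_le_sq _ (by positivity)
  rw [norm_add_sq_real, real_inner_smul_right, norm_smul, Real.norm_of_nonneg ha]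
  have h1 : ‖L x‖ ^ 2 ≤ ‖L‖ ^ 2 * ‖x‖ ^ 2 := by
    rw [← mul_pow]; gcongr; exact L.le_opNorm x
  have h2 : a * (a * ‖L x‖ ^ 2) ≤ a * (c * ‖x‖ ^ 2) := by
    refine mul_le_mul_of_nonneg_left ?_ ha
    calc a * ‖L x‖ ^ 2 ≤ a * (‖L‖ ^ 2 * ‖x‖ ^ 2) := by gcongr
      _ = a * ‖L‖ ^ 2 * ‖x‖ ^ 2 := by ring
      _ ≤ _ := by gcongr
  have h3 := mul_le_mul_of_nonneg_left (hL x) ha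
  nlinarith [mul_nonneg (sq_nonneg (c / 2 * a)) (sq_nonneg ‖x‖)]

/-- Pathwise convergence of linear stochastic approximation: if the drift `L` is strictly
dissipative and the step-size weighted noise series converge, the recursion tends to zero. -/
lemma tendsto_zero_of_linear_recursion {L : E →L[ℝ] E} {c : ℝ} (hc : 0 < c)
    (hL : ∀ x, inner ℝ x (L x) ≤ -c * ‖x‖ ^ 2)
    {α : ℕ → ℝ} (hα : ∀ t, 0 < α t) (hα0 : Tendsto α atTop (nhds 0))
    (hαdiv : Tendsto (fun n => ∑ t ∈ Finset.range n, α t) atTop atTop)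
    {A : ℕ → E →L[ℝ] E} {h : ℕ → E} {B : ℝ} (hA : ∀ t, ‖A t‖ ≤ B) (hh : ∀ t, ‖h t‖ ≤ B)
    {S : E →L[ℝ] E}
    (hS : Tendsto (fun n => ∑ t ∈ Finset.range n, α t • (A t - L)) atTop (nhds S))
    {T : E} (hT : Tendsto (fun n => ∑ t ∈ Finset.range n, α t • h t) atTop (nhds T))
    {e : ℕ → E} (he : ∀ t, e (t + 1) = e t + α t • (A t (e t) + h t)) :
    Tendsto e atTop (nhds 0) := by
  set U : ℕ → E →L[ℝ] E := fun n => S - ∑ t ∈ Finset.range n, α t • (A t - L) with hU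
  set W : ℕ → E := fun n => T - ∑ t ∈ Finset.range n, α t • h t with hW
  have hU0 : Tendsto (fun n => ‖U n‖) atTop (nhds 0) := by
    have := (tendsto_const_nhds (x := S)).sub hS
    rw [sub_self] at this
    simpa using this.norm
  have hW0 : Tendsto (fun n => ‖W n‖) atTop (nhds 0) := by
    have := (tendsto_const_nhds (x := T)).sub hT
    rw [sub_self] at this
    simpa using this.norm
  have hUs : ∀ t, U (t + 1) = U t - α t • (A t - L) := fun t => by
    simp only [hU, Finset.sum_range_succ]; abel
  have hWs : ∀ t, W (t + 1) = W t - α t • h t := fun t => by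
    simp only [hW, Finset.sum_range_succ]; abel
  set u : ℕ → E := fun t => e t + U t (e t) + W t with hu
  set p : ℕ → E := fun t => U (t + 1) (A t (e t) + h t) - L (U t (e t) + W t) with hp
  have hB : 0 ≤ B := (norm_nonneg _).trans (hA 0)
  have hrec : ∀ t, u (t + 1) = (u t + α t • L (u t)) + α t • p t := by
    intro t
    have h1 : U (t + 1) (e (t + 1)) = U (t + 1) (e t) + α t • U (t + 1) (A t (e t) + h t) := by
      rw [he t, map_add, map_smul]
    have h2 : U (t + 1) (e t) = U t (e t) - α t • (A t (e t) - L (e t)) := by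
      rw [hUs]; simp
    simp only [hu, hp]
    rw [h1, h2, hWs, he t]
    simp only [map_add, smul_add, smul_sub]
    abel
  have he_le : ∀ᶠ t in atTop, ‖e t‖ ≤ 2 * (‖u t‖ + ‖W t‖) := by
    filter_upwards [hU0.eventually_le_const (show (0 : ℝ) < 1 / 2 by norm_num)] with t ht
    have h1 : e t = u t - U t (e t) - W t := by simp only [hu]; abel
    have h2 : ‖e t‖ ≤ ‖u t‖ + ‖U t (e t)‖ + ‖W t‖ := by
      calc ‖e t‖ = ‖u t - U t (e t) - W t‖ := by rw [← h1]
        _ ≤ ‖u t - U t (e t)‖ + ‖W t‖ := norm_sub_le _ _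
        _ ≤ _ := by gcongr; exact norm_sub_le _ _
    have h3 : ‖U t (e t)‖ ≤ 1 / 2 * ‖e t‖ := (U t).le_of_opNorm_le ht _
    linarith
  have hp_le : ∀ η > 0, ∀ᶠ t in atTop, ‖p t‖ ≤ η * (‖u t‖ + 1) := by
    intro η hη
    set δ : ℕ → ℝ := fun t =>
      ‖U (t + 1)‖ * (2 * B + 3 * B) + ‖L‖ * (2 * ‖U t‖ + ‖W t‖ + 2 * ‖U t‖)
    have hδ : Tendsto δ atTop (nhds 0) := by
      have h1 := ((tendsto_add_atTop_iff_nat 1).2 hU0).mul_const (2 * B + 3 * B)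
      have h2 := (((hU0.const_mul 2).add hW0).add (hU0.const_mul 2)).const_mul ‖L‖
      simpa using h1.add h2
    filter_upwards [he_le, hδ.eventually_le_const hη,
      hW0.eventually_le_const (show (0 : ℝ) < 1 by norm_num)] with t h1 h2 h3
    have h4 : ‖e t‖ ≤ 2 * (‖u t‖ + 1) := by linarith
    have hu1 : (1 : ℝ) ≤ ‖u t‖ + 1 := by linarith [norm_nonneg (u t)]
    calc ‖p t‖ ≤ ‖U (t + 1) (A t (e t) + h t)‖ + ‖L (U t (e t) + W t)‖ := norm_sub_le _ _
      _ ≤ ‖U (t + 1)‖ * (B * ‖e t‖ + B) + ‖L‖ * (‖U t‖ * ‖e t‖ + ‖W t‖) := by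
        gcongr
        · refine (U (t + 1)).le_opNorm_of_le ((norm_add_le _ _).trans ?_)
          exact add_le_add ((A t).le_of_opNorm_le (hA t) _) (hh t)
        · refine L.le_opNorm_of_le ((norm_add_le _ _).trans ?_)
          gcongr
          exact (U t).le_opNorm _
      _ ≤ ‖U (t + 1)‖ * (B * (2 * (‖u t‖ + 1)) + B * (‖u t‖ + 1)) +
          ‖L‖ * (‖U t‖ * (2 * (‖u t‖ + 1)) + ‖W t‖ * (‖u t‖ + 1)) := by
        gcongr
        · exact le_mul_of_one_le_right hB hu1
        · exact le_mul_of_one_le_right (norm_nonneg _) hu1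
      _ ≤ δ t * (‖u t‖ + 1) := by
        simp only [δ]
        have : 0 ≤ ‖U (t + 1)‖ * (2 * B) + ‖L‖ * (2 * ‖U t‖) := by positivity
        nlinarith [mul_nonneg this (zero_le_one.trans hu1)]
      _ ≤ _ := by gcongr
  have hu_lim : Tendsto (fun t => ‖u t‖) atTop (nhds 0) := by
    refine tendsto_zero_of_le_one_sub_mul_add (κ := c / 4) (by positivity)
      (fun t => norm_nonneg _) hα0 hαdiv fun η hη => ?_
    have hs1 : ∀ᶠ t in atTop, α t * ‖L‖ ^ 2 ≤ c := by
      have := hα0.mul_const (‖L‖ ^ 2)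
      rw [zero_mul] at this
      exact this.eventually_le_const hc
    have hs2 : ∀ᶠ t in atTop, α t * c ≤ 1 := by
      have := hα0.mul_const c
      rw [zero_mul] at this
      exact this.eventually_le_const one_pos
    filter_upwards [hs1, hs2, hp_le (min η (c / 4)) (by positivity)] with t h1 h2 h3
    have h4 := norm_add_smul_le_of_inner_le hL (hα t).le h1 h2 (u t)
    have h5 : ‖p t‖ ≤ c / 4 * ‖u t‖ + η := by
      calc ‖p t‖ ≤ min η (c / 4) * ‖u t‖ + min η (c / 4) := by linarith
        _ ≤ _ := by
          gcongr
          · exact min_le_right _ _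
          · exact min_le_left _ _
    rw [hrec]
    calc _ ≤ ‖u t + α t • L (u t)‖ + ‖α t • p t‖ := norm_add_le _ _
      _ ≤ (1 - c / 2 * α t) * ‖u t‖ + α t * (c / 4 * ‖u t‖ + η) := by
        rw [norm_smul, Real.norm_of_nonneg (hα t).le]
        gcongr
        exact (hα t).le
      _ = _ := by ring
  rw [tendsto_zero_iff_norm_tendsto_zero]
  have hb := (hu_lim.add hW0).const_mul 2
  simp only [add_zero, mul_zero] at hb
  exact tendsto_of_tendsto_of_tendsto_of_le_of_le' tendsto_const_nhds hb
    (Eventually.of_forall fun t => norm_nonneg _) he_le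

end LinearRecursion

section Poisson

variable {S : Type*} [Fintype S]

lemma norm_mulVec_le_of_nonneg_of_sum_eq {A : Matrix S S ℝ} (hA : ∀ x y, 0 ≤ A x y) {r : ℝ}
    (hr : 0 ≤ r) (hrow : ∀ x, ∑ y, A x y = r) (g : S → ℝ) : ‖A *ᵥ g‖ ≤ r * ‖g‖ := by
  refine (pi_norm_le_iff_of_nonneg (by positivity)).2 fun x => ?_
  calc ‖(A *ᵥ g) x‖ ≤ ∑ y, ‖A x y * g y‖ := norm_sum_le _ _
    _ ≤ ∑ y, A x y * ‖g‖ := by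
      refine Finset.sum_le_sum fun y _ => ?_
      rw [norm_mul, Real.norm_of_nonneg (hA x y)]
      exact mul_le_mul_of_nonneg_left (norm_le_pi_norm g y) (hA x y)
    _ = r * ‖g‖ := by rw [← Finset.sum_mul, hrow]

variable [DecidableEq S]

/-- Under a Doeblin minorization, the iterates of a stochastic matrix contract centered functions
geometrically. -/
lemma exists_norm_pow_mulVec_le_of_doeblin {Q : Matrix S S ℝ} (hQ : Q ∈ rowStochastic ℝ S)
    {p : S → ℝ} (hpsum : ∑ x, p x = 1) (hp : p ᵥ* Q = p) {N : ℕ} (hN : N ≠ 0)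
    {δ : ℝ} (hδ0 : 0 < δ) (hδ1 : δ < 1) (hδ : ∀ x y, δ * p y ≤ (Q ^ N) x y)
    {g : S → ℝ} (hg : p ⬝ᵥ g = 0) :
    ∃ C ρ : ℝ, 0 < ρ ∧ ρ < 1 ∧ ∀ k, ‖(Q ^ k) *ᵥ g‖ ≤ C * ρ ^ k := by
  have hpow : ∀ k, p ᵥ* (Q ^ k) = p := by
    intro k
    induction k with
    | zero => simp
    | succ k ih => rw [pow_succ, ← vecMul_vecMul, ih, hp]
  have hcent : ∀ k, p ⬝ᵥ ((Q ^ k) *ᵥ g) = 0 := fun k => by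
    rw [dotProduct_mulVec, hpow, hg]
  have hrow : ∀ k x, ∑ y, (Q ^ k) x y = 1 := fun k x =>
    sum_row_of_mem_rowStochastic (pow_mem hQ k) x
  have hstep : ∀ f : S → ℝ, p ⬝ᵥ f = 0 → ‖(Q ^ N) *ᵥ f‖ ≤ (1 - δ) * ‖f‖ := by
    intro f hf
    have h1 : (Q ^ N) *ᵥ f = (Q ^ N - of fun _ y => δ * p y) *ᵥ f := by
      ext x
      have : ∑ y, δ * p y * f y = 0 := by
        simp only [mul_assoc, ← Finset.mul_sum]
        change δ * (p ⬝ᵥ f) = 0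
        rw [hf, mul_zero]
      simp [mulVec, dotProduct, sub_mul, this]
    rw [h1]
    refine norm_mulVec_le_of_nonneg_of_sum_eq (fun x y => ?_) (by linarith) (fun x => ?_) f
    · simpa using hδ x y
    · simp [hrow, ← Finset.mul_sum, hpsum]
  set ρ : ℝ := (1 - δ) ^ ((N : ℝ)⁻¹) with hρ
  have hρN : ρ ^ N = 1 - δ := Real.rpow_inv_natCast_pow (by linarith) hN
  have hρ0 : 0 < ρ := Real.rpow_pos_of_pos (by linarith) _
  have hρ1 : ρ < 1 := Real.rpow_lt_one (by linarith) (by linarith) (by positivity)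
  refine ⟨‖g‖ / ρ ^ N, ρ, hρ0, hρ1, fun k => ?_⟩
  induction k using Nat.strong_induction_on with
  | _ k ih =>
    by_cases hk : k < N
    · have h1 := norm_mulVec_le_of_nonneg_of_sum_eq
        (fun _ _ => nonneg_of_mem_rowStochastic (pow_mem hQ k)) zero_le_one (hrow k) g
      rw [one_mul] at h1
      refine h1.trans ?_
      rw [div_mul_eq_mul_div, le_div_iff₀ (by positivity)]
      exact mul_le_mul_of_nonneg_left (pow_le_pow_of_le_one hρ0.le hρ1.le hk.le) (norm_nonneg _)
    · obtain ⟨j, rfl⟩ := Nat.exists_eq_add_of_le (not_lt.1 hk)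
      rw [pow_add, ← mulVec_mulVec]
      calc _ ≤ (1 - δ) * ‖(Q ^ j) *ᵥ g‖ := hstep _ (hcent j)
        _ ≤ (1 - δ) * (‖g‖ / ρ ^ N * ρ ^ j) := by
          refine mul_le_mul_of_nonneg_left (ih j (by lia)) (by linarith)
        _ = _ := by rw [pow_add, ← hρN]; ring

/-- Discounted forward sums of a square-summable sequence are square-summable. -/
lemma summable_sq_tsum_mul_geometric {α : ℕ → ℝ} (hα0 : ∀ t, 0 ≤ α t) (hα1 : ∀ t, α t ≤ 1)
    (hαsq : Summable fun t => α t ^ 2) {ρ : ℝ} (hρ0 : 0 < ρ) (hρ1 : ρ < 1) :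
    (∀ j, Summable fun k => α (j + k) * ρ ^ k) ∧
      Summable fun j => (∑' k, α (j + k) * ρ ^ k) ^ 2 := by
  have hgeom := summable_geometric_of_lt_one hρ0.le hρ1
  have hle : ∀ j k, α (j + k) * ρ ^ k ≤ ρ ^ k := fun j k =>
    mul_le_of_le_one_left (by positivity) (hα1 _)
  have hsum : ∀ j, Summable fun k => α (j + k) * ρ ^ k := fun j =>
    hgeom.of_nonneg_of_le (fun k => mul_nonneg (hα0 _) (by positivity)) (hle j)
  refine ⟨hsum, ?_⟩
  set b : ℕ → ℝ := fun j => ∑' k, α (j + k) * ρ ^ k with hb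
  have hb0 : ∀ j, 0 ≤ b j := fun j => tsum_nonneg fun k => mul_nonneg (hα0 _) (by positivity)
  have hb1 : ∀ j, b j ≤ (1 - ρ)⁻¹ := fun j => by
    rw [← tsum_geometric_of_lt_one hρ0.le hρ1]
    exact (hsum j).tsum_le_tsum (hle j) hgeom
  have hrec : ∀ j, b j = α j + ρ * b (j + 1) := by
    intro j
    simp only [hb]
    rw [(hsum j).tsum_eq_zero_add, ← tsum_mul_left]
    simp only [add_zero, pow_zero, mul_one]
    congr 1
    refine tsum_congr fun k => ?_
    rw [show j + (k + 1) = j + 1 + k by ring]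
    ring
  have hρ' : 0 < 1 - ρ := by linarith
  have hsq : ∀ j, b j ^ 2 ≤ α j ^ 2 / (1 - ρ) + ρ * b (j + 1) ^ 2 := by
    intro j
    rw [hrec j]
    have h2 : α j ^ 2 / (1 - ρ) + ρ * b (j + 1) ^ 2 - (α j + ρ * b (j + 1)) ^ 2
        = ρ * (α j - (1 - ρ) * b (j + 1)) ^ 2 / (1 - ρ) := by
      field_simp
      ring
    have h3 : 0 ≤ ρ * (α j - (1 - ρ) * b (j + 1)) ^ 2 / (1 - ρ) := by positivity
    linarith
  refine summable_of_sum_range_le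
    (c := ((∑' t, α t ^ 2) / (1 - ρ) + ρ * (1 - ρ)⁻¹ ^ 2) / (1 - ρ))
    (fun j => sq_nonneg _) fun n => ?_
  have h1 : ∑ j ∈ Finset.range n, b j ^ 2 ≤
      ∑ j ∈ Finset.range n, (α j ^ 2 / (1 - ρ) + ρ * b (j + 1) ^ 2) :=
    Finset.sum_le_sum fun j _ => hsq j
  rw [Finset.sum_add_distrib, ← Finset.sum_div, ← Finset.mul_sum] at h1
  have h2 := Finset.sum_range_succ' (fun j => b j ^ 2) n
  rw [Finset.sum_range_succ] at h2
  have h3 : ∑ j ∈ Finset.range n, b (j + 1) ^ 2 ≤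
      ∑ j ∈ Finset.range n, b j ^ 2 + (1 - ρ)⁻¹ ^ 2 := by
    have := pow_le_pow_left₀ (hb0 n) (hb1 n) 2
    have := sq_nonneg (b 0)
    linarith
  have h4 : (∑ j ∈ Finset.range n, α j ^ 2) / (1 - ρ) ≤ (∑' t, α t ^ 2) / (1 - ρ) := by
    gcongr
    exact hαsq.sum_le_tsum _ fun _ _ => sq_nonneg _
  have h5 := mul_le_mul_of_nonneg_left h3 hρ0.le
  rw [le_div_iff₀ hρ']
  linarith

/-- Solutions of the time-inhomogeneous Poisson equation `V_j = α_j g + Q V_{j+1}`. -/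
lemma exists_inhomogeneous_poisson {Q : Matrix S S ℝ} {g : S → ℝ} {C ρ : ℝ}
    (hρ0 : 0 < ρ) (hρ1 : ρ < 1) (hdecay : ∀ k, ‖(Q ^ k) *ᵥ g‖ ≤ C * ρ ^ k)
    {α : ℕ → ℝ} (hα0 : ∀ t, 0 ≤ α t) (hα1 : ∀ t, α t ≤ 1) (hαsq : Summable fun t => α t ^ 2) :
    ∃ V : ℕ → S → ℝ, (∀ j, V j = α j • g + Q *ᵥ V (j + 1)) ∧
      Summable fun j => ‖V j‖ ^ 2 := by
  obtain ⟨hs, hsq⟩ := summable_sq_tsum_mul_geometric hα0 hα1 hαsq hρ0 hρ1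
  have hle : ∀ j k, ‖α (j + k) • (Q ^ k) *ᵥ g‖ ≤ C * (α (j + k) * ρ ^ k) := by
    intro j k
    rw [norm_smul, Real.norm_of_nonneg (hα0 _)]
    calc _ ≤ α (j + k) * (C * ρ ^ k) := mul_le_mul_of_nonneg_left (hdecay k) (hα0 _)
      _ = _ := by ring
  have hsum : ∀ j, Summable fun k => α (j + k) • (Q ^ k) *ᵥ g := fun j =>
    Summable.of_norm_bounded ((hs j).mul_left C) (hle j)
  refine ⟨fun j => ∑' k, α (j + k) • (Q ^ k) *ᵥ g, fun j => ?_, ?_⟩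
  · beta_reduce
    rw [(hsum j).tsum_eq_zero_add]
    have h1 := (LinearMap.toContinuousLinearMap (Matrix.mulVecLin Q)).map_tsum (hsum (j + 1))
    simp only [LinearMap.coe_toContinuousLinearMap', mulVecLin_apply] at h1
    rw [h1]
    simp only [add_zero, pow_zero, one_mulVec]
    congr 1
    refine tsum_congr fun k => ?_
    rw [mulVec_smul, mulVec_mulVec, ← pow_succ', show j + (k + 1) = j + 1 + k by ring]
  · refine (hsq.mul_left (C ^ 2)).of_nonneg_of_le (fun j => sq_nonneg _) fun j => ?_
    rw [← mul_pow]
    refine pow_le_pow_left₀ (norm_nonneg _) ?_ 2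
    rw [← tsum_mul_left]
    exact tsum_of_norm_bounded ((hs j).mul_left C).hasSum (hle j)

end Poisson

section MarkovChain

variable {Ω : Type*} [MeasurableSpace Ω] {S : Type*}

/-- The history `(X_0, …, X_n)` of a process. -/
def processHistory (X : ℕ → Ω → S) (n : ℕ) (ω : Ω) : Fin (n + 1) → S := fun k => X k ω

/-- `X` has the Markov property on cylinders with transition matrix `Q` under `μ`. -/
def IsMarkovChainWith (μ : Measure Ω) (Q : Matrix S S ℝ) (X : ℕ → Ω → S) : Prop :=
  ∀ n (f : Fin (n + 1) → S) (y : S),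
    μ.real {ω | processHistory X n ω = f ∧ X (n + 1) ω = y} =
      μ.real {ω | processHistory X n ω = f} * Q (f (Fin.last n)) y

variable [MeasurableSpace S]

lemma measurable_processHistory {X : ℕ → Ω → S} (hX : ∀ t, Measurable (X t)) (n : ℕ) :
    Measurable (processHistory X n) :=
  measurable_pi_lambda _ fun k => hX k

/-- The filtration generated by the histories of a process. -/
def historyFiltration {X : ℕ → Ω → S} (hX : ∀ t, Measurable (X t)) :
    Filtration ℕ (inferInstance : MeasurableSpace Ω) where
  seq n := MeasurableSpace.comap (processHistory X n) inferInstance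
  mono' := by
    intro i j hij
    have h : processHistory X i =
        (fun f (k : Fin (i + 1)) => f (Fin.castLE (by lia) k)) ∘ processHistory X j := rfl
    beta_reduce
    rw [h, ← MeasurableSpace.comap_comp]
    exact MeasurableSpace.comap_mono (Measurable.comap_le (by fun_prop))
  le' n := (measurable_processHistory hX n).comap_le

lemma measurable_historyFiltration {X : ℕ → Ω → S} (hX : ∀ t, Measurable (X t)) {k n : ℕ}
    (hk : k ≤ n) : Measurable[historyFiltration hX n] (X k) := by
  have h : X k = (fun f : Fin (n + 1) → S => f ⟨k, by lia⟩) ∘ processHistory X n := rfl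
  rw [h]
  exact (measurable_pi_apply _).comp (comap_measurable _)

variable [Fintype S] [MeasurableSingletonClass S] {μ : Measure Ω} [IsProbabilityMeasure μ]
  {Q : Matrix S S ℝ} {X : ℕ → Ω → S}

/-- Increments with zero conditional mean are orthogonal to functions of the history. -/
lemma integral_history_mul_eq_zero (hX : ∀ t, Measurable (X t)) (hM : IsMarkovChainWith μ Q X)
    {H : S → S → ℝ} (hH : ∀ x, ∑ y, Q x y * H x y = 0) (n : ℕ) (ψ : (Fin (n + 1) → S) → ℝ) :
    ∫ ω, ψ (processHistory X n ω) * H (X n ω) (X (n + 1) ω) ∂μ = 0 := by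
  classical
  set Y : Ω → (Fin (n + 1) → S) × S := fun ω => (processHistory X n ω, X (n + 1) ω)
  have hY : Measurable Y := (measurable_processHistory hX n).prodMk (hX _)
  have hfin : IsFiniteMeasure (μ.map Y) := by infer_instance
  set F : (Fin (n + 1) → S) × S → ℝ := fun q => ψ q.1 * H (q.1 (Fin.last n)) q.2
  calc ∫ ω, ψ (processHistory X n ω) * H (X n ω) (X (n + 1) ω) ∂μ
      = ∫ ω, F (Y ω) ∂μ := rfl
    _ = ∫ q, F q ∂(μ.map Y) :=
      (integral_map hY.aemeasurable (Measurable.of_discrete).aestronglyMeasurable).symm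
    _ = ∑ q, (μ.map Y).real {q} • F q := integral_fintype Integrable.of_finite
    _ = ∑ f, ∑ y, μ.real {ω | processHistory X n ω = f} * ψ f *
          (Q (f (Fin.last n)) y * H (f (Fin.last n)) y) := by
      rw [Fintype.sum_prod_type]
      refine Finset.sum_congr rfl fun f _ => Finset.sum_congr rfl fun y _ => ?_
      rw [map_measureReal_apply hY (measurableSet_singleton _)]
      have h1 : Y ⁻¹' {(f, y)} = {ω | processHistory X n ω = f ∧ X (n + 1) ω = y} := by
        ext ω
        simp [Y]
      rw [h1, hM n f y, smul_eq_mul]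
      simp only [F]
      ring
    _ = 0 := by simp [← Finset.mul_sum, hH]

/-- Sums of square-summably bounded martingale increments along a finite Markov chain converge
almost surely. -/
lemma ae_exists_tendsto_sum_of_centered (hX : ∀ t, Measurable (X t))
    (hM : IsMarkovChainWith μ Q X) {H : ℕ → S → S → ℝ} (hH : ∀ t x, ∑ y, Q x y * H t x y = 0)
    {c : ℕ → ℝ} (hHc : ∀ t x y, |H t x y| ≤ c t) (hc : Summable fun t => c t ^ 2) :
    ∀ᵐ ω ∂μ, ∃ l, Tendsto (fun n => ∑ t ∈ Finset.range n, H t (X t ω) (X (t + 1) ω))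
      atTop (nhds l) := by
  set d : ℕ → Ω → ℝ := fun t ω => H t (X t ω) (X (t + 1) ω) with hd
  set M : ℕ → Ω → ℝ := fun n ω => ∑ t ∈ Finset.range n, d t ω with hMdef
  have hdmeas : ∀ {n t}, t < n → Measurable[historyFiltration hX n] (d t) := by
    intro n t ht
    have h1 : Measurable (fun q : S × S => H t q.1 q.2) := Measurable.of_discrete
    exact h1.comp ((measurable_historyFiltration hX ht.le).prodMk
      (measurable_historyFiltration hX ht))
  have hMmeas : ∀ n, Measurable[historyFiltration hX n] (M n) := fun n =>
    Finset.measurable_fun_sum _ fun t ht => hdmeas (Finset.mem_range.1 ht)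
  have hdm : ∀ t, Measurable (d t) := fun t =>
    (hdmeas t.lt_succ_self).mono ((historyFiltration hX).le _) le_rfl
  have hMm : ∀ n, Measurable (M n) := fun n => (hMmeas n).mono ((historyFiltration hX).le _) le_rfl
  have hMb : ∀ n ω, |M n ω| ≤ ∑ t ∈ Finset.range n, c t := fun n ω =>
    (Finset.abs_sum_le_sum_abs _ _).trans (Finset.sum_le_sum fun t _ => hHc _ _ _)
  have hc0 : ∀ t, 0 ≤ c t := fun t => by
    obtain ⟨ω⟩ : Nonempty Ω := nonempty_of_isProbabilityMeasure μ
    exact (abs_nonneg _).trans (hHc t (X t ω) (X t ω))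
  have hdint : ∀ t, Integrable (d t) μ := fun t =>
    Integrable.of_bound (hdm t).aestronglyMeasurable (c t) (ae_of_all _ fun ω => hHc _ _ _)
  have hMint : ∀ n, Integrable (M n) μ := fun n => integrable_finsetSum _ fun t _ => hdint t
  have hMsucc : ∀ n ω, M (n + 1) ω = M n ω + d n ω := fun n ω => Finset.sum_range_succ _ _
  have hmart : Martingale M (historyFiltration hX) μ := by
    refine martingale_of_setIntegral_eq_succ (fun n => (hMmeas n).stronglyMeasurable) hMint ?_
    rintro n _ ⟨B, hB, rfl⟩
    have hBm : MeasurableSet (processHistory X n ⁻¹' B) := measurable_processHistory hX n hB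
    simp only [hMsucc]
    rw [integral_add (hMint n).integrableOn (hdint n).integrableOn,
      ← integral_indicator hBm (f := d n)]
    have h1 : (processHistory X n ⁻¹' B).indicator (d n) = fun ω =>
        B.indicator (fun _ => (1 : ℝ)) (processHistory X n ω) * H n (X n ω) (X (n + 1) ω) := by
      classical
      ext ω
      simp [Set.indicator_apply, hd]
    rw [h1, integral_history_mul_eq_zero hX hM (hH n), add_zero]
  have horth : ∀ n, ∫ ω, M n ω * d n ω ∂μ = 0 := by
    intro n
    rw [← integral_history_mul_eq_zero hX hM (hH n) n
      (fun f => ∑ t : Fin n, H t (f t.castSucc) (f t.succ))]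
    refine integral_congr_ae (ae_of_all _ fun ω => ?_)
    simp only [hMdef, Finset.sum_range]
    rfl
  have hMsq : ∀ n, Integrable (fun ω => M n ω ^ 2) μ := fun n =>
    Integrable.of_bound ((hMm n).pow_const 2).aestronglyMeasurable
      ((∑ t ∈ Finset.range n, c t) ^ 2) (ae_of_all _ fun ω => by
        rw [norm_pow]; exact pow_le_pow_left₀ (norm_nonneg _) (hMb n ω) 2)
  have hdsq : ∀ t, Integrable (fun ω => d t ω ^ 2) μ := fun t =>
    Integrable.of_bound ((hdm t).pow_const 2).aestronglyMeasurable
      (c t ^ 2) (ae_of_all _ fun ω => by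
        rw [norm_pow]; exact pow_le_pow_left₀ (norm_nonneg _) (hHc _ _ _) 2)
  have hMd : ∀ n, Integrable (fun ω => M n ω * d n ω) μ := fun n =>
    Integrable.of_bound ((hMm n).mul (hdm n)).aestronglyMeasurable
      ((∑ t ∈ Finset.range n, c t) * c n) (ae_of_all _ fun ω => by
        rw [norm_mul]
        exact mul_le_mul (hMb n ω) (hHc _ _ _) (norm_nonneg _)
          (Finset.sum_nonneg fun t _ => hc0 t))
  have hL2 : ∀ n, ∫ ω, M n ω ^ 2 ∂μ ≤ ∑ t ∈ Finset.range n, c t ^ 2 := by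
    intro n
    induction n with
    | zero => simp [hMdef]
    | succ n ih =>
      have h1 : (fun ω => M (n + 1) ω ^ 2) =
          fun ω => (M n ω ^ 2 + 2 * (M n ω * d n ω)) + d n ω ^ 2 := by
        ext ω
        rw [hMsucc]
        ring
      have h2 : ∫ ω, d n ω ^ 2 ∂μ ≤ c n ^ 2 := by
        have h3 : ∫ ω, d n ω ^ 2 ∂μ ≤ ∫ _, c n ^ 2 ∂μ :=
          integral_mono (hdsq n) (integrable_const _) fun ω => by
            have := pow_le_pow_left₀ (abs_nonneg _) (hHc n (X n ω) (X (n + 1) ω)) 2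
            rwa [sq_abs] at this
        simpa using h3
      have h4 : Integrable (fun ω => M n ω ^ 2 + 2 * (M n ω * d n ω)) μ :=
        (hMsq n).add ((hMd n).const_mul 2)
      rw [h1, integral_add h4 (hdsq n),
        integral_add (hMsq n) ((hMd n).const_mul 2), integral_const_mul, horth,
        Finset.sum_range_succ]
      linarith
  have hL1 : ∀ n, eLpNorm (M n) 1 μ ≤ ((1 + ∑' t, c t ^ 2).toNNReal : ENNReal) := by
    intro n
    rw [eLpNorm_one_eq_lintegral_enorm, ← ofReal_integral_norm_eq_lintegral_enorm (hMint n)]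
    refine ENNReal.ofReal_le_ofReal ?_
    calc ∫ ω, ‖M n ω‖ ∂μ ≤ ∫ ω, (1 + M n ω ^ 2) ∂μ :=
          integral_mono (hMint n).norm ((integrable_const _).add (hMsq n)) fun ω => by
            rw [Real.norm_eq_abs]
            nlinarith [sq_nonneg (|M n ω| - 1), sq_abs (M n ω), abs_nonneg (M n ω)]
      _ = 1 + ∫ ω, M n ω ^ 2 ∂μ := by
        rw [integral_add (integrable_const _) (hMsq n)]; simp
      _ ≤ _ := by
        have := hc.sum_le_tsum (Finset.range n) fun _ _ => sq_nonneg _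
        linarith [hL2 n]
  filter_upwards [hmart.submartingale.ae_tendsto_limitProcess hL1] with ω hω
  exact ⟨_, hω⟩

/-- Step-size weighted, centered additive functionals of an ergodic finite Markov chain converge
almost surely, for arbitrary square-summable step sizes. -/
lemma ae_exists_tendsto_weighted_sum_of_markov [DecidableEq S] (hX : ∀ t, Measurable (X t))
    (hM : IsMarkovChainWith μ Q X) (hQ : Q ∈ rowStochastic ℝ S)
    {p : S → ℝ} (hpsum : ∑ x, p x = 1) (hp : p ᵥ* Q = p) {N : ℕ} (hN : N ≠ 0)
    {δ : ℝ} (hδ0 : 0 < δ) (hδ1 : δ < 1) (hδ : ∀ x y, δ * p y ≤ (Q ^ N) x y)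
    {α : ℕ → ℝ} (hα0 : ∀ t, 0 ≤ α t) (hα1 : ∀ t, α t ≤ 1) (hαsq : Summable fun t => α t ^ 2)
    (F : S → S → ℝ) (hF : ∑ x, ∑ y, p x * Q x y * F x y = 0) :
    ∀ᵐ ω ∂μ, ∃ l, Tendsto (fun n => ∑ t ∈ Finset.range n, α t * F (X t ω) (X (t + 1) ω))
      atTop (nhds l) := by
  set g : S → ℝ := fun x => ∑ y, Q x y * F x y with hg
  have hpg : p ⬝ᵥ g = 0 := by
    simpa [dotProduct, hg, Finset.mul_sum, mul_assoc] using hF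
  obtain ⟨C, ρ, hρ0, hρ1, hdecay⟩ :=
    exists_norm_pow_mulVec_le_of_doeblin hQ hpsum hp hN hδ0 hδ1 hδ hpg
  obtain ⟨V, hV, hVsq⟩ := exists_inhomogeneous_poisson hρ0 hρ1 hdecay hα0 hα1 hαsq
  have hrow : ∀ x, ∑ y, Q x y = 1 := sum_row_of_mem_rowStochastic hQ
  set H : ℕ → S → S → ℝ := fun t x y =>
    α t * (F x y - g x) + (V (t + 1) y - (Q *ᵥ V (t + 1)) x) with hH
  obtain ⟨B, hB⟩ : ∃ B, ∀ q : S × S, |F q.1 q.2 - g q.1| ≤ B :=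
    (Set.finite_range fun q : S × S => |F q.1 q.2 - g q.1|).bddAbove.imp
      fun B hB q => hB (Set.mem_range_self q)
  have hHc : ∀ t x y, |H t x y| ≤ B * α t + 2 * ‖V (t + 1)‖ := by
    intro t x y
    have h1 : |α t * (F x y - g x)| ≤ B * α t := by
      rw [abs_mul, abs_of_nonneg (hα0 t), mul_comm]
      exact mul_le_mul_of_nonneg_right (hB (x, y)) (hα0 t)
    have h2 : |V (t + 1) y| ≤ ‖V (t + 1)‖ := norm_le_pi_norm (V (t + 1)) y
    have h3 : |(Q *ᵥ V (t + 1)) x| ≤ ‖V (t + 1)‖ := by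
      have h4 := norm_mulVec_le_of_nonneg_of_sum_eq
        (fun _ _ => nonneg_of_mem_rowStochastic hQ) zero_le_one hrow (V (t + 1))
      rw [one_mul] at h4
      exact (norm_le_pi_norm (Q *ᵥ V (t + 1)) x).trans h4
    calc |H t x y| ≤ |α t * (F x y - g x)| + (|V (t + 1) y| + |(Q *ᵥ V (t + 1)) x|) :=
          (abs_add_le _ _).trans (add_le_add le_rfl (abs_sub _ _))
      _ ≤ _ := by linarith
  have hHsq : Summable fun t => (B * α t + 2 * ‖V (t + 1)‖) ^ 2 := by
    have h1 := (hαsq.mul_left (2 * B ^ 2)).add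
      (((summable_nat_add_iff 1).2 hVsq).mul_left 8)
    refine h1.of_nonneg_of_le (fun t => sq_nonneg _) fun t => ?_
    nlinarith [sq_nonneg (B * α t - 2 * ‖V (t + 1)‖)]
  have hH0 : ∀ t x, ∑ y, Q x y * H t x y = 0 := by
    intro t x
    have h1 : ∑ y, Q x y * H t x y = α t * ((∑ y, Q x y * F x y) - (∑ y, Q x y) * g x) +
        ((Q *ᵥ V (t + 1)) x - (∑ y, Q x y) * (Q *ᵥ V (t + 1)) x) := by
      have h2 : (Q *ᵥ V (t + 1)) x = ∑ y, Q x y * V (t + 1) y := rfl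
      nth_rewrite 1 [h2]
      rw [Finset.sum_mul, Finset.sum_mul, ← Finset.sum_sub_distrib, ← Finset.sum_sub_distrib,
        Finset.mul_sum, ← Finset.sum_add_distrib]
      refine Finset.sum_congr rfl fun y _ => ?_
      simp only [hH]
      ring
    rw [h1, hrow]
    simp [hg]
  have hVlim : Tendsto (fun t => ‖V t‖) atTop (nhds 0) := by
    have h1 := hVsq.tendsto_atTop_zero.sqrt
    simpa [Real.sqrt_sq (norm_nonneg _)] using h1
  filter_upwards [ae_exists_tendsto_sum_of_centered hX hM hH0 hHc hHsq] with ω ⟨l, hl⟩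
  have hVX : Tendsto (fun n => V n (X n ω)) atTop (nhds 0) :=
    squeeze_zero_norm (fun n => norm_le_pi_norm (V n) (X n ω)) hVlim
  refine ⟨l + (V 0 (X 0 ω) - 0), ?_⟩
  refine (hl.add (tendsto_const_nhds.sub hVX)).congr fun n => ?_
  induction n with
  | zero => simp
  | succ n ih =>
    rw [Finset.sum_range_succ, Finset.sum_range_succ, ← ih]
    have h1 : V n (X n ω) = α n * g (X n ω) + (Q *ᵥ V (n + 1)) (X n ω) := by
      have := congrFun (hV n) (X n ω)
      simpa using this
    simp only [hH]
    linarith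

end MarkovChain

section TemporalDifference

variable {m K : ℕ}

/-- The stationary quadratic form of a stochastic matrix is bounded by the weighted `ℓ²` norm. -/
lemma sum_stationary_mul_mul_le {P : Matrix (Fin m) (Fin m) ℝ} (hPnn : ∀ i j, 0 ≤ P i j)
    (hProw : ∀ i, ∑ j, P i j = 1) {π : Fin m → ℝ} (hπ : ∀ s, 0 ≤ π s)
    (hπstat : π ᵥ* P = π) (v : Fin m → ℝ) :
    ∑ a, ∑ b, π a * P a b * (v a * v b) ≤ ∑ a, π a * v a ^ 2 := by
  have h1 : ∑ a, ∑ b, π a * P a b * v a ^ 2 = ∑ a, π a * v a ^ 2 := by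
    refine Finset.sum_congr rfl fun a _ => ?_
    rw [← Finset.sum_mul, ← Finset.mul_sum, hProw, mul_one]
  have h2 : ∑ a, ∑ b, π a * P a b * v b ^ 2 = ∑ a, π a * v a ^ 2 := by
    rw [Finset.sum_comm]
    refine Finset.sum_congr rfl fun b _ => ?_
    rw [← Finset.sum_mul]
    congr 1
    exact congrFun hπstat b
  have h3 : ∑ a, ∑ b, π a * P a b * (v a * v b) ≤
      ∑ a, ∑ b, (π a * P a b * v a ^ 2 + π a * P a b * v b ^ 2) / 2 := by
    refine Finset.sum_le_sum fun a _ => Finset.sum_le_sum fun b _ => ?_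
    have := mul_nonneg (mul_nonneg (hπ a) (hPnn a b)) (sq_nonneg (v a - v b))
    linarith
  simp only [← Finset.sum_div, Finset.sum_add_distrib, h1, h2] at h3
  linarith

/-- The mean TD(0) matrix `Φᵀ D (γ P - 1) Φ` is negative definite. -/
lemma td_matrix_dotProduct_neg {P : Matrix (Fin m) (Fin m) ℝ} (hPnn : ∀ i j, 0 ≤ P i j)
    (hProw : ∀ i, ∑ j, P i j = 1) {π : Fin m → ℝ} (hπ : ∀ s, 0 < π s)
    (hπstat : π ᵥ* P = π) {Φ : Matrix (Fin m) (Fin K) ℝ} (hΦ : Function.Injective Φ.mulVec)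
    {γ : ℝ} (hγ0 : 0 < γ) (hγ1 : γ < 1) {x : Fin K → ℝ} (hx : x ≠ 0) :
    x ⬝ᵥ ((Φᵀ * diagonal π * (γ • P - 1) * Φ) *ᵥ x) < 0 := by
  set v := Φ *ᵥ x with hv
  have hv0 : v ≠ 0 := fun h => hx (hΦ (by rw [← hv, h, mulVec_zero]))
  have h1 : x ⬝ᵥ ((Φᵀ * diagonal π * (γ • P - 1) * Φ) *ᵥ x) =
      v ⬝ᵥ (diagonal π *ᵥ ((γ • P - 1) *ᵥ v)) := by
    rw [← mulVec_mulVec, ← mulVec_mulVec, ← mulVec_mulVec, dotProduct_mulVec, vecMul_transpose]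
  have h2 : v ⬝ᵥ (diagonal π *ᵥ ((γ • P - 1) *ᵥ v)) =
      γ * ∑ a, ∑ b, π a * P a b * (v a * v b) - ∑ a, π a * v a ^ 2 := by
    simp only [sub_mulVec, one_mulVec, smul_mulVec, dotProduct, mulVec_diagonal, Pi.sub_apply,
      Pi.smul_apply, smul_eq_mul]
    rw [Finset.mul_sum, ← Finset.sum_sub_distrib]
    refine Finset.sum_congr rfl fun a _ => ?_
    have h3 : (P *ᵥ v) a = ∑ b, P a b * v b := rfl
    rw [h3, mul_sub, mul_sub, Finset.mul_sum, Finset.mul_sum, Finset.mul_sum, Finset.mul_sum]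
    congr 1
    · exact Finset.sum_congr rfl fun b _ => by ring
    · ring
  have h3 := sum_stationary_mul_mul_le hPnn hProw (fun s => (hπ s).le) hπstat v
  have h4 : 0 < ∑ a, π a * v a ^ 2 := by
    obtain ⟨a, ha⟩ := Function.ne_iff.1 hv0
    have ha' : v a ≠ 0 := ha
    refine Finset.sum_pos' (fun a _ => mul_nonneg (hπ a).le (sq_nonneg _))
      ⟨a, Finset.mem_univ a, mul_pos (hπ a) (by positivity)⟩
  rw [h1, h2]
  nlinarith

lemma isUnit_det_of_dotProduct_mulVec_neg {A : Matrix (Fin K) (Fin K) ℝ}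
    (hA : ∀ x, x ≠ 0 → x ⬝ᵥ (A *ᵥ x) < 0) : IsUnit A.det := by
  rw [isUnit_iff_ne_zero]
  intro h
  obtain ⟨x, hx, hx0⟩ := exists_mulVec_eq_zero_iff.2 h
  have := hA x hx
  simp [hx0] at this

/-- The Bernoulli weights of the contamination indicator: `true` marks a clean observation. -/
def contaminationWeight (ε : ℝ) (z : Bool) : ℝ := if z then 1 - ε else ε

/-- Transition matrix of the state chain paired with i.i.d. contamination indicators. -/
def contaminatedTransition (P : Matrix (Fin m) (Fin m) ℝ) (ε : ℝ) :
    Matrix (Fin m × Bool) (Fin m × Bool) ℝ :=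
  of fun x y => P x.1 y.1 * contaminationWeight ε y.2

/-- Stationary law of the state chain paired with i.i.d. contamination indicators. -/
def contaminatedStationary (π : Fin m → ℝ) (ε : ℝ) (x : Fin m × Bool) : ℝ :=
  π x.1 * contaminationWeight ε x.2

lemma contaminationWeight_nonneg {ε : ℝ} (hε0 : 0 ≤ ε) (hε1 : ε < 1 / 2) (z : Bool) :
    0 ≤ contaminationWeight ε z := by
  cases z <;> simp [contaminationWeight] <;> linarith

lemma contaminationWeight_true_add_false (ε : ℝ) :
    contaminationWeight ε true + contaminationWeight ε false = 1 := by
  simp [contaminationWeight]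

lemma contaminatedTransition_mem_rowStochastic {P : Matrix (Fin m) (Fin m) ℝ}
    (hPnn : ∀ i j, 0 ≤ P i j) (hProw : ∀ i, ∑ j, P i j = 1)
    {ε : ℝ} (hε0 : 0 ≤ ε) (hε1 : ε < 1 / 2) :
    contaminatedTransition P ε ∈ rowStochastic ℝ (Fin m × Bool) := by
  refine mem_rowStochastic_iff_sum.2
    ⟨fun x y => mul_nonneg (hPnn _ _) (contaminationWeight_nonneg hε0 hε1 _), fun x => ?_⟩
  simp [contaminatedTransition, Fintype.sum_prod_type, ← mul_add,
    contaminationWeight_true_add_false, hProw]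

lemma sum_contaminatedStationary {π : Fin m → ℝ} (hπsum : ∑ s, π s = 1) (ε : ℝ) :
    ∑ x, contaminatedStationary π ε x = 1 := by
  simp [contaminatedStationary, Fintype.sum_prod_type, ← mul_add,
    contaminationWeight_true_add_false, hπsum]

lemma contaminatedStationary_vecMul {P : Matrix (Fin m) (Fin m) ℝ} {π : Fin m → ℝ}
    (hπstat : π ᵥ* P = π) (ε : ℝ) :
    contaminatedStationary π ε ᵥ* contaminatedTransition P ε = contaminatedStationary π ε := by
  ext y
  have h1 : ∑ a, π a * P a y.1 = π y.1 := congrFun hπstat y.1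
  simp only [vecMul, dotProduct, contaminatedStationary, contaminatedTransition, of_apply,
    Fintype.sum_prod_type, Fintype.sum_bool]
  rw [← h1, Finset.sum_mul]
  refine Finset.sum_congr rfl fun a _ => ?_
  linear_combination (π a * P a y.1 * contaminationWeight ε y.2) *
    contaminationWeight_true_add_false ε

lemma contaminatedTransition_pow_succ (P : Matrix (Fin m) (Fin m) ℝ) (ε : ℝ) (n : ℕ) :
    contaminatedTransition P ε ^ (n + 1) = contaminatedTransition (P ^ (n + 1)) ε := by
  induction n with
  | zero => simp
  | succ n ih =>
    rw [pow_succ, ih, pow_succ P (n + 1)]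
    ext x y
    simp only [mul_apply, contaminatedTransition, of_apply, Fintype.sum_prod_type,
      Fintype.sum_bool]
    rw [Finset.sum_mul]
    refine Finset.sum_congr rfl fun a _ => ?_
    linear_combination ((P ^ (n + 1)) x.1 a * P a y.1 * contaminationWeight ε y.2) *
      contaminationWeight_true_add_false ε

/-- An ergodic transition matrix makes the contaminated chain satisfy a Doeblin condition. -/
lemma exists_doeblin_contaminatedTransition {P : Matrix (Fin m) (Fin m) ℝ}
    (hPnn : ∀ i j, 0 ≤ P i j) (hProw : ∀ i, ∑ j, P i j = 1)
    (hPerg : ∃ n : ℕ, ∀ i j, 0 < (P ^ n) i j)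
    {π : Fin m → ℝ} (hπpos : ∀ s, 0 < π s) (hπsum : ∑ s, π s = 1)
    {ε : ℝ} (hε0 : 0 ≤ ε) (hε1 : ε < 1 / 2) :
    ∃ N ≠ 0, ∃ δ > 0, δ < 1 ∧ ∀ x y,
      δ * contaminatedStationary π ε y ≤ (contaminatedTransition P ε ^ N) x y := by
  obtain ⟨n, hn⟩ := hPerg
  have hn' : ∀ i j, 0 < (P ^ (n + 1)) i j := by
    intro i j
    rw [pow_succ', mul_apply]
    obtain ⟨a, -, ha⟩ : ∃ a ∈ Finset.univ, 0 < P i a :=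
      Finset.exists_lt_of_sum_lt (f := fun _ => (0 : ℝ)) (by simp [hProw])
    exact Finset.sum_pos' (fun b _ => mul_nonneg (hPnn _ _) (hn _ _).le)
      ⟨a, Finset.mem_univ a, mul_pos ha (hn a j)⟩
  obtain ⟨η, hη0, hη⟩ : ∃ η > 0, ∀ q : Fin m × Fin m, η ≤ (P ^ (n + 1)) q.1 q.2 := by
    rcases isEmpty_or_nonempty (Fin m × Fin m) with hE | hE
    · exact ⟨1, one_pos, fun q => hE.elim q⟩
    · obtain ⟨q, hq⟩ := Finite.exists_min fun q : Fin m × Fin m => (P ^ (n + 1)) q.1 q.2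
      exact ⟨_, hn' q.1 q.2, hq⟩
  have hπ1 : ∀ s, π s ≤ 1 := fun s => by
    rw [← hπsum]
    exact Finset.single_le_sum (fun a _ => (hπpos a).le) (Finset.mem_univ s)
  refine ⟨n + 1, by lia, min η (1 / 2), by positivity,
    (min_le_right _ _).trans_lt (by norm_num), fun x y => ?_⟩
  rw [contaminatedTransition_pow_succ]
  simp only [contaminatedStationary, contaminatedTransition, of_apply]
  rw [← mul_assoc]
  refine mul_le_mul_of_nonneg_right ?_ (contaminationWeight_nonneg hε0 hε1 _)
  calc min η (1 / 2) * π y.1 ≤ min η (1 / 2) * 1 :=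
        mul_le_mul_of_nonneg_left (hπ1 _) (by positivity)
    _ ≤ η := by rw [mul_one]; exact min_le_left _ _
    _ ≤ _ := hη (x.1, y.1)

/-- The paired process of states and contamination indicators is a Markov chain. -/
lemma isMarkovChainWith_contaminatedTransition {Ω : Type*} [MeasurableSpace Ω] {Pr : Measure Ω}
    {P : Matrix (Fin m) (Fin m) ℝ} (hPnn : ∀ i j, 0 ≤ P i j)
    {ε : ℝ} (hε0 : 0 ≤ ε) (hε1 : ε < 1 / 2) {ν : Fin m → ℝ}
    {s : ℕ → Ω → Fin m} {Z : ℕ → Ω → Bool}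
    (hlaw : ∀ n : ℕ, ∀ f : Fin (n + 1) → Fin m, ∀ g : Fin (n + 1) → Bool,
      Pr {ω | (∀ k : Fin (n + 1), s k ω = f k) ∧ ∀ k : Fin (n + 1), Z k ω = g k} =
        ENNReal.ofReal (ν (f 0)) *
          (∏ k : Fin n, ENNReal.ofReal (P (f k.castSucc) (f k.succ))) *
          ∏ k : Fin (n + 1),
            (if g k then ENNReal.ofReal (1 - ε) else ENNReal.ofReal ε)) :
    IsMarkovChainWith Pr (contaminatedTransition P ε) fun t ω => (s t ω, Z t ω) := by
  intro n f y
  set f₁ : Fin (n + 2) → Fin m := Fin.snoc (α := fun _ => Fin m) (fun k => (f k).1) y.1 with hf₁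
  set f₂ : Fin (n + 2) → Bool := Fin.snoc (α := fun _ => Bool) (fun k => (f k).2) y.2 with hf₂
  have h1 : {ω | processHistory (fun t ω => (s t ω, Z t ω)) n ω = f ∧
      (s (n + 1) ω, Z (n + 1) ω) = y} =
      {ω | (∀ k : Fin (n + 2), s k ω = f₁ k) ∧ ∀ k : Fin (n + 2), Z k ω = f₂ k} := by
    ext ω
    simp only [Set.mem_ofPred_eq, Fin.forall_fin_succ', hf₁, hf₂, Fin.snoc_castSucc,
      Fin.snoc_last, processHistory, funext_iff, Prod.ext_iff, Fin.val_castSucc, Fin.val_last,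
      forall_and]
    tauto
  have h2 : {ω | processHistory (fun t ω => (s t ω, Z t ω)) n ω = f} =
      {ω | (∀ k : Fin (n + 1), s k ω = (f k).1) ∧ ∀ k : Fin (n + 1), Z k ω = (f k).2} := by
    ext ω
    simp only [Set.mem_ofPred_eq, processHistory, funext_iff, Prod.ext_iff, forall_and]
  have hw : ∀ z : Bool, (if z then ENNReal.ofReal (1 - ε) else ENNReal.ofReal ε) =
      ENNReal.ofReal (contaminationWeight ε z) := by
    intro z
    cases z <;> simp [contaminationWeight]
  have h3 : Pr {ω | (∀ k : Fin (n + 2), s k ω = f₁ k) ∧ ∀ k : Fin (n + 2), Z k ω = f₂ k} =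
      Pr {ω | (∀ k : Fin (n + 1), s k ω = (f k).1) ∧ ∀ k : Fin (n + 1), Z k ω = (f k).2} *
        ENNReal.ofReal (contaminatedTransition P ε (f (Fin.last n)) y) := by
    rw [hlaw (n + 1) f₁ f₂, hlaw n (fun k => (f k).1) (fun k => (f k).2)]
    rw [Fin.prod_univ_castSucc (n := n), Fin.prod_univ_castSucc (n := n + 1)]
    have h0 : f₁ 0 = (f 0).1 := by
      rw [hf₁, ← Fin.castSucc_zero, Fin.snoc_castSucc]
    simp only [hw, Fin.succ_castSucc, Fin.succ_last, h0]
    simp only [hf₁, hf₂, Fin.snoc_castSucc, Fin.snoc_last]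
    rw [contaminatedTransition, of_apply, ENNReal.ofReal_mul (hPnn _ _)]
    ring
  change Pr.real {ω | processHistory (fun t ω => (s t ω, Z t ω)) n ω = f ∧
      (s (n + 1) ω, Z (n + 1) ω) = y} = _
  rw [h1, h2, measureReal_def, h3, ENNReal.toReal_mul, ENNReal.toReal_ofReal, measureReal_def]
  exact mul_nonneg (hPnn _ _) (contaminationWeight_nonneg hε0 hε1 _)

end TemporalDifference

section TemporalDifferenceConvergence

variable {m K : ℕ}

/-- Expectations under the stationary contaminated pair law reduce to the state chain. -/
lemma sum_contaminated_pair (P : Matrix (Fin m) (Fin m) ℝ) (π : Fin m → ℝ) (ε : ℝ)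
    (G : Fin m → Bool → Fin m → ℝ) :
    ∑ x, ∑ y, contaminatedStationary π ε x * contaminatedTransition P ε x y * G x.1 x.2 y.1 =
      ∑ a, ∑ b, π a * P a b * ((1 - ε) * G a true b + ε * G a false b) := by
  simp only [contaminatedStationary, contaminatedTransition, of_apply, Fintype.sum_prod_type,
    Fintype.sum_bool, ← Finset.sum_add_distrib]
  refine Finset.sum_congr rfl fun a _ => Finset.sum_congr rfl fun b _ => ?_
  simp only [contaminationWeight]
  simp
  ring

/-- The random TD(0) matrix attached to a transition `a → b`. -/
def tdMatrix (Φ : Matrix (Fin m) (Fin K) ℝ) (γ : ℝ) (a b : Fin m) : Matrix (Fin K) (Fin K) ℝ :=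
  vecMulVec (Φ a) (γ • Φ b - Φ a)

lemma tdMatrix_mulVec (Φ : Matrix (Fin m) (Fin K) ℝ) (γ : ℝ) (a b : Fin m) (x : Fin K → ℝ) :
    tdMatrix Φ γ a b *ᵥ x = (γ * (Φ b ⬝ᵥ x) - Φ a ⬝ᵥ x) • Φ a := by
  rw [tdMatrix, vecMulVec_mulVec, op_smul_eq_smul, sub_dotProduct, smul_dotProduct, smul_eq_mul]

lemma sum_stationary_tdMatrix {P : Matrix (Fin m) (Fin m) ℝ} (hProw : ∀ i, ∑ j, P i j = 1)
    (π : Fin m → ℝ) (Φ : Matrix (Fin m) (Fin K) ℝ) (γ : ℝ) (i j : Fin K) :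
    ∑ a, ∑ b, π a * P a b * tdMatrix Φ γ a b i j =
      (Φᵀ * diagonal π * (γ • P - 1) * Φ : Matrix (Fin K) (Fin K) ℝ) i j := by
  rw [Matrix.mul_assoc, mul_apply]
  refine Finset.sum_congr rfl fun a _ => ?_
  rw [mul_diagonal, transpose_apply, Matrix.sub_mul, Matrix.one_mul, Matrix.smul_mul,
    Matrix.sub_apply, Matrix.smul_apply, smul_eq_mul, mul_apply]
  have h1 : ∑ b, π a * P a b * tdMatrix Φ γ a b i j =
      ∑ b, (Φ a i * π a * (γ * (P a b * Φ b j)) - Φ a i * π a * Φ a j * P a b) := by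
    refine Finset.sum_congr rfl fun b _ => ?_
    simp only [tdMatrix, vecMulVec_apply, Pi.sub_apply, Pi.smul_apply, smul_eq_mul]
    ring
  rw [h1, Finset.sum_sub_distrib, ← Finset.mul_sum, ← Finset.mul_sum, ← Finset.mul_sum, hProw]
  ring

lemma sum_stationary_reward {P : Matrix (Fin m) (Fin m) ℝ} (hProw : ∀ i, ∑ j, P i j = 1)
    (π : Fin m → ℝ) (Φ : Matrix (Fin m) (Fin K) ℝ) (r : Fin m → ℝ) (i : Fin K) :
    ∑ a, ∑ b, π a * P a b * (r a * Φ a i) = ((Φᵀ * diagonal π) *ᵥ r) i := by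
  simp only [mulVec, dotProduct, mul_diagonal, transpose_apply]
  refine Finset.sum_congr rfl fun a _ => ?_
  rw [← Finset.sum_mul, ← Finset.mul_sum, hProw]
  ring

/-- Pathwise convergence of TD(0) given convergence of the step-size weighted noise series. -/
lemma tendsto_td_of_tendsto_noise {A : ℕ → Matrix (Fin K) (Fin K) ℝ} {h : ℕ → Fin K → ℝ}
    {L : Matrix (Fin K) (Fin K) ℝ} (hL : ∀ x, x ≠ 0 → x ⬝ᵥ (L *ᵥ x) < 0)
    {α : ℕ → ℝ} (hα : ∀ t, 0 < α t) (hα0 : Tendsto α atTop (nhds 0))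
    (hαdiv : Tendsto (fun n => ∑ t ∈ Finset.range n, α t) atTop atTop)
    (hA : (Set.range A).Finite) (hh : (Set.range h).Finite)
    (hS : ∀ i j, ∃ l, Tendsto (fun n => ∑ t ∈ Finset.range n, α t * (A t i j - L i j))
      atTop (nhds l))
    (hT : ∀ i, ∃ l, Tendsto (fun n => ∑ t ∈ Finset.range n, α t * h t i) atTop (nhds l))
    {e : ℕ → Fin K → ℝ} (he : ∀ t, e (t + 1) = e t + α t • (A t *ᵥ e t + h t)) :
    Tendsto e atTop (nhds 0) := by
  set J := toEuclideanCLM (n := Fin K) (𝕜 := ℝ) with hJ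
  choose S hS using hS
  choose T hT using hT
  have hJc : Continuous J :=
    LinearMap.continuous_of_finiteDimensional (J.toAlgEquiv.toLinearMap :
      Matrix (Fin K) (Fin K) ℝ →ₗ[ℝ] (EuclideanSpace ℝ (Fin K) →L[ℝ] EuclideanSpace ℝ (Fin K)))
  have hS' : Tendsto (fun n => ∑ t ∈ Finset.range n, α t • (J (A t) - J L)) atTop
      (nhds (J (of S))) := by
    have h1 : Tendsto (fun n => ∑ t ∈ Finset.range n, α t • (A t - L)) atTop (nhds (of S)) := by
      refine tendsto_pi_nhds.2 fun i => tendsto_pi_nhds.2 fun j => ?_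
      refine (hS i j).congr fun n => ?_
      simp [Matrix.sum_apply]
    refine ((hJc.tendsto _).comp h1).congr fun n => ?_
    simp
  have hT' : Tendsto (fun n => ∑ t ∈ Finset.range n, α t • WithLp.toLp 2 (h t)) atTop
      (nhds (WithLp.toLp 2 T)) := by
    have h1 : Tendsto (fun n => ∑ t ∈ Finset.range n, α t • h t) atTop (nhds T) := by
      refine tendsto_pi_nhds.2 fun i => ?_
      refine (hT i).congr fun n => ?_
      simp
    refine (((PiLp.continuous_toLp 2 _).tendsto _).comp h1).congr fun n => ?_
    simp
  obtain ⟨B₁, hB₁⟩ : BddAbove (Set.range fun t => ‖J (A t)‖) := by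
    have h1 := (hA.image fun M => ‖J M‖).bddAbove
    rwa [← Set.range_comp] at h1
  obtain ⟨B₂, hB₂⟩ : BddAbove (Set.range fun t => ‖WithLp.toLp 2 (h t)‖) := by
    have h1 := (hh.image fun v => ‖WithLp.toLp 2 v‖).bddAbove
    rwa [← Set.range_comp] at h1
  obtain ⟨c, hc, hLc⟩ := exists_inner_le_neg_mul_sq_of_inner_neg (J L) fun x hx => by
    rw [hJ, inner_toEuclideanCLM]
    exact hL _ fun h0 => hx (by ext i; exact congrFun h0 i)
  have hlim := tendsto_zero_of_linear_recursion hc hLc hα hα0 hαdiv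
    (A := fun t => J (A t)) (h := fun t => WithLp.toLp 2 (h t)) (B := max B₁ B₂)
    (fun t => (hB₁ (Set.mem_range_self t)).trans (le_max_left _ _))
    (fun t => (hB₂ (Set.mem_range_self t)).trans (le_max_right _ _)) hS' hT'
    (e := fun t => WithLp.toLp 2 (e t)) fun t => by
      rw [he t, hJ, toEuclideanCLM_toLp]
      simp
  exact ((PiLp.continuous_ofLp 2 _).tendsto _).comp hlim

end TemporalDifferenceConvergence

/-- **Vulnerability of TD(0) under the Huber-contaminated noiseless reward model.**
The Markov chain `(s_t)` evolves according to an irreducible aperiodic row-stochastic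
matrix `P` with stationary distribution `π` from an arbitrary initial distribution `ν`;
at each time, independently of everything else, with probability `1−ε` the learner
observes the true mean reward `R(s_t)` and with probability `ε` the corrupted signal
`C(s_t)`. If the step sizes satisfy `∑ α_t = ∞` and `∑ α_t² < ∞`, then the TD(0)
iterates converge almost surely to `θ̃* = (1−ε)θ* + ε(−Ā⁻¹ΦᵀDC)` with
`θ* = −Ā⁻¹ΦᵀDR`; moreover (for `ε > 0`) every `w ∈ ℝ^K` is the limit `θ̃*`
corresponding to some corrupted reward vector `C_w`. -/
theorem td0_vulnerability_huber_contamination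
    {Ω : Type*} [MeasurableSpace Ω] (Pr : Measure Ω) [IsProbabilityMeasure Pr]
    (m K : ℕ)
    -- the Markov transition matrix: row-stochastic, irreducible and aperiodic
    (P : Matrix (Fin m) (Fin m) ℝ)
    (hPnn : ∀ i j, 0 ≤ P i j) (hProw : ∀ i, ∑ j, P i j = 1)
    (hPerg : ∃ n : ℕ, ∀ i j, 0 < (P ^ n) i j)
    -- its stationary distribution
    (π : Fin m → ℝ) (hπpos : ∀ s, 0 < π s) (hπsum : ∑ s, π s = 1)
    (hπstat : Matrix.vecMul π P = π)
    -- features: full column rank, normalized rows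
    (Φ : Matrix (Fin m) (Fin K) ℝ)
    (hΦrank : Function.Injective Φ.mulVec)
    (hΦnorm : ∀ x : Fin m, Φ x ⬝ᵥ Φ x ≤ 1)
    -- discount factor and corruption probability
    (γ : ℝ) (hγ0 : 0 < γ) (hγ1 : γ < 1)
    (ε : ℝ) (hε0 : 0 ≤ ε) (hε1 : ε < 1 / 2)
    -- true mean rewards and the (bounded, deterministic) corruption signal
    (R C : Fin m → ℝ)
    -- the state process and corruption indicators, with arbitrary initial law ν:
    (ν : Fin m → ℝ) (hνnn : ∀ x, 0 ≤ ν x) (hνsum : ∑ x, ν x = 1)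
    (s : ℕ → Ω → Fin m) (Z : ℕ → Ω → Bool)
    (hsmeas : ∀ t, Measurable (s t)) (hZmeas : ∀ t, Measurable (Z t))
    -- joint law: Markov chain `ν, P`, and i.i.d. Bernoulli(1−ε) indicators,
    -- independent of the chain (specified on all finite cylinders)
    (hlaw : ∀ n : ℕ, ∀ f : Fin (n + 1) → Fin m, ∀ g : Fin (n + 1) → Bool,
      Pr {ω | (∀ k : Fin (n + 1), s k ω = f k) ∧ ∀ k : Fin (n + 1), Z k ω = g k} =
        ENNReal.ofReal (ν (f 0)) *
          (∏ k : Fin n, ENNReal.ofReal (P (f k.castSucc) (f k.succ))) *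
          ∏ k : Fin (n + 1),
            (if g k then ENNReal.ofReal (1 - ε) else ENNReal.ofReal ε))
    -- observed rewards
    (rtil : ℕ → Ω → ℝ)
    (hrtil : ∀ t ω, rtil t ω = if Z t ω then R (s t ω) else C (s t ω))
    -- step sizes: `∑ α_t = ∞`, `∑ α_t² < ∞`
    (α : ℕ → ℝ) (hαpos : ∀ t, 0 < α t) (hα1 : ∀ t, α t < 1)
    (hαdiv : Tendsto (fun n => ∑ t ∈ Finset.range n, α t) atTop atTop)
    (hαsq : Summable fun t => (α t) ^ 2)
    -- the TD(0) iterates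
    (θ₀ : Fin K → ℝ) (θ : ℕ → Ω → Fin K → ℝ)
    (hθ0 : ∀ ω, θ 0 ω = θ₀)
    (hθupd : ∀ t ω, θ (t + 1) ω = θ t ω +
      α t • ((rtil t ω + γ * (Φ (s (t + 1) ω) ⬝ᵥ θ t ω) - Φ (s t ω) ⬝ᵥ θ t ω) •
        Φ (s t ω)))
    -- steady-state quantities
    (D : Matrix (Fin m) (Fin m) ℝ) (hD : D = Matrix.diagonal π)
    (Abar : Matrix (Fin K) (Fin K) ℝ) (hAbar : Abar = Φᵀ * D * (γ • P - 1) * Φ)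
    (θstar : Fin K → ℝ) (hθstar : θstar = -(Abar⁻¹.mulVec ((Φᵀ * D).mulVec R))) :
    (∀ᵐ ω ∂Pr, Tendsto (fun t => θ t ω) atTop
      (nhds ((1 - ε) • θstar + ε • -(Abar⁻¹.mulVec ((Φᵀ * D).mulVec C))))) ∧
    (0 < ε → ∀ w : Fin K → ℝ, ∃ Cw : Fin m → ℝ,
      (1 - ε) • θstar + ε • -(Abar⁻¹.mulVec ((Φᵀ * D).mulVec Cw)) = w) := by
  have hneg : ∀ x, x ≠ 0 → x ⬝ᵥ (Abar *ᵥ x) < 0 := by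
    intro x hx
    rw [hAbar, hD]
    exact td_matrix_dotProduct_neg hPnn hProw hπpos hπstat hΦrank hγ0 hγ1 hx
  have hdet := isUnit_det_of_dotProduct_mulVec_neg hneg
  constructor
  · set w : Fin K → ℝ := (1 - ε) • θstar + ε • -(Abar⁻¹ *ᵥ ((Φᵀ * D) *ᵥ C)) with hw
    have hAw : (Φᵀ * D) *ᵥ ((1 - ε) • R + ε • C) + Abar *ᵥ w = 0 := by
      have h1 : ∀ v, Abar *ᵥ (Abar⁻¹ *ᵥ v) = v := fun v => by
        rw [mulVec_mulVec, mul_nonsing_inv _ hdet, one_mulVec]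
      rw [hw, hθstar, mulVec_add, mulVec_add, mulVec_smul, mulVec_smul, mulVec_smul,
        mulVec_smul, mulVec_neg, mulVec_neg, h1, h1]
      simp only [smul_neg]
      abel
    obtain ⟨N, hN, δ, hδ0, hδ1, hδ⟩ :=
      exists_doeblin_contaminatedTransition hPnn hProw hPerg hπpos hπsum hε0 hε1
    have hconv : ∀ G : Fin m → Bool → Fin m → ℝ,
        ∑ a, ∑ b, π a * P a b * ((1 - ε) * G a true b + ε * G a false b) = 0 →
        ∀ᵐ ω ∂Pr, ∃ l, Tendsto (fun n => ∑ t ∈ Finset.range n,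
          α t * G (s t ω) (Z t ω) (s (t + 1) ω)) atTop (nhds l) := fun G hG =>
      ae_exists_tendsto_weighted_sum_of_markov (fun t => (hsmeas t).prodMk (hZmeas t))
        (isMarkovChainWith_contaminatedTransition hPnn hε0 hε1 hlaw)
        (contaminatedTransition_mem_rowStochastic hPnn hProw hε0 hε1)
        (sum_contaminatedStationary hπsum ε) (contaminatedStationary_vecMul hπstat ε)
        hN hδ0 hδ1 hδ (fun t => (hαpos t).le) (fun t => (hα1 t).le) hαsq
        (fun x y => G x.1 x.2 y.1) (by rw [sum_contaminated_pair, hG])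
    have hone : ∑ a, ∑ b, π a * P a b = 1 := by
      simp [← Finset.mul_sum, hProw, hπsum]
    have hmean : ∀ i j, ∑ a, ∑ b, π a * P a b * tdMatrix Φ γ a b i j = Abar i j := fun i j => by
      rw [sum_stationary_tdMatrix hProw, hAbar, hD]
    have hS : ∀ᵐ ω ∂Pr, ∀ i j, ∃ l, Tendsto (fun n => ∑ t ∈ Finset.range n,
        α t * (tdMatrix Φ γ (s t ω) (s (t + 1) ω) i j - Abar i j)) atTop (nhds l) := by
      refine ae_all_iff.2 fun i => ae_all_iff.2 fun j => ?_
      refine hconv (fun a _ b => tdMatrix Φ γ a b i j - Abar i j) ?_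
      have h1 : ∀ a b, π a * P a b * ((1 - ε) * (tdMatrix Φ γ a b i j - Abar i j) +
          ε * (tdMatrix Φ γ a b i j - Abar i j)) =
          π a * P a b * tdMatrix Φ γ a b i j - π a * P a b * Abar i j := fun a b => by ring
      simp only [h1, Finset.sum_sub_distrib, hmean, ← Finset.sum_mul, hone]
      ring
    set r : Fin m → Bool → ℝ := fun a z => if z then R a else C a with hr
    set h : Fin m → Bool → Fin m → Fin K → ℝ := fun a z b =>
      r a z • Φ a + tdMatrix Φ γ a b *ᵥ w with hh
    have hT : ∀ᵐ ω ∂Pr, ∀ i, ∃ l, Tendsto (fun n => ∑ t ∈ Finset.range n,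
        α t * h (s t ω) (Z t ω) (s (t + 1) ω) i) atTop (nhds l) := by
      refine ae_all_iff.2 fun i => hconv (fun a z b => h a z b i) ?_
      have h1 : ∀ a b, π a * P a b * ((1 - ε) * h a true b i + ε * h a false b i) =
          π a * P a b * (((1 - ε) • R + ε • C) a * Φ a i) +
            ∑ j, π a * P a b * tdMatrix Φ γ a b i j * w j := by
        intro a b
        have h2 : ∑ j, π a * P a b * tdMatrix Φ γ a b i j * w j =
            π a * P a b * (tdMatrix Φ γ a b *ᵥ w) i := by
          simp only [mul_assoc, ← Finset.mul_sum]
          rfl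
        rw [h2]
        simp only [hh, hr, Pi.add_apply, Pi.smul_apply, smul_eq_mul, if_true,
          Bool.false_eq_true, if_false]
        ring
      have h3 : ∑ a, ∑ b, ∑ j, π a * P a b * tdMatrix Φ γ a b i j * w j = (Abar *ᵥ w) i := by
        have h4 : (Abar *ᵥ w) i = ∑ j, Abar i j * w j := rfl
        simp only [h4, ← hmean, Finset.sum_mul]
        rw [Finset.sum_comm]
        simp only [Finset.sum_comm (s := (Finset.univ : Finset (Fin K)))]
        rw [Finset.sum_comm]
      simp only [h1, Finset.sum_add_distrib]
      rw [h3, sum_stationary_reward hProw, ← hD]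
      exact congrFun hAw i
    have hα0 : Tendsto α atTop (nhds 0) := by
      have h1 := hαsq.tendsto_atTop_zero.sqrt
      simpa [Real.sqrt_sq (hαpos _).le] using h1
    filter_upwards [hS, hT] with ω hSω hTω
    have hlim := tendsto_td_of_tendsto_noise hneg hαpos hα0 hαdiv
      (A := fun t => tdMatrix Φ γ (s t ω) (s (t + 1) ω))
      (h := fun t => h (s t ω) (Z t ω) (s (t + 1) ω))
      ((Set.finite_range fun q : Fin m × Fin m => tdMatrix Φ γ q.1 q.2).subset (by
        rintro _ ⟨t, rfl⟩
        exact ⟨(s t ω, s (t + 1) ω), rfl⟩))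
      ((Set.finite_range fun q : Fin m × Bool × Fin m => h q.1 q.2.1 q.2.2).subset (by
        rintro _ ⟨t, rfl⟩
        exact ⟨(s t ω, Z t ω, s (t + 1) ω), rfl⟩))
      hSω hTω (e := fun t => θ t ω - w) (fun t => by
        rw [hθupd, hrtil]
        simp only [hh, hr, mulVec_sub, tdMatrix_mulVec]
        module)
    simpa using hlim.add_const w
  · intro hε w
    refine ⟨(γ • P - 1) *ᵥ (Φ *ᵥ (ε⁻¹ • ((1 - ε) • θstar - w))), ?_⟩
    rw [mulVec_mulVec (M := Φᵀ * D), mulVec_mulVec (N := Φ), ← hAbar, mulVec_mulVec,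
      nonsing_inv_mul _ hdet, one_mulVec, smul_neg, smul_smul, mul_inv_cancel₀ hε.ne', one_smul]
    abel
end

section
/- Let D = diag(π) with π(s) > 0 for all s, let Φ ∈ ℝ^{m×K} have full column rank, let Ā ∈ ℝ^{K×K} be invertible, let ε ∈ (0,1), and let R ∈ ℝ^m with θ* = −Ā⁻¹ΦᵀDR. Then for every w ∈ ℝ^K, the vector C_w = (1/ε) D⁻¹ Φ (ΦᵀΦ)⁻¹ Ā ((1−ε)θ* − w) satisfies −Ā⁻¹ΦᵀD((1−ε)R + εC_w) = w. In particular, the Huber-perturbed TD(0) fixed point −Ā⁻¹ΦᵀD((1−ε)R + εC) can be made equal to any prescribed point of ℝ^K by a suitable choice of the corruption vector C. -/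
open Matrix

/-- The Gram matrix of a real matrix with full column rank is invertible. -/
theorem isUnit_det_transpose_mul_self_of_injective_mulVec {m n : Type*} [Fintype m] [Fintype n]
    [DecidableEq n] {A : Matrix m n ℝ} (hA : Function.Injective A.mulVec) :
    IsUnit (Aᵀ * A).det := by
  have h := (Matrix.PosDef.conjTranspose_mul_self A hA).isUnit
  rw [Matrix.conjTranspose_eq_transpose_of_trivial] at h
  exact (Matrix.isUnit_iff_isUnit_det _).1 h

/-- **The Huber-perturbed TD(0) fixed point can be placed anywhere.**
Let `D = diag(π)` with `π(s) > 0` for all `s`, let `Φ ∈ ℝ^{m×K}` have full column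
rank, let `Ā ∈ ℝ^{K×K}` be invertible, let `ε ∈ (0,1)`, and let `R ∈ ℝ^m` with
`θ* = −Ā⁻¹ΦᵀDR`. Then for every `w ∈ ℝ^K`, the vector
`C_w = (1/ε) D⁻¹ Φ (ΦᵀΦ)⁻¹ Ā ((1−ε)θ* − w)` satisfies
`−Ā⁻¹ΦᵀD((1−ε)R + εC_w) = w`. In particular, the perturbed fixed point
`−Ā⁻¹ΦᵀD((1−ε)R + εC)` can be made equal to any prescribed point of `ℝ^K`. -/
theorem huber_td_fixed_point_arbitrary
    (m K : ℕ) (π : Fin m → ℝ) (hπ : ∀ s, 0 < π s)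
    (Φ : Matrix (Fin m) (Fin K) ℝ)
    (hΦ : Function.Injective Φ.mulVec)  -- full column rank
    (Abar : Matrix (Fin K) (Fin K) ℝ) (hA : IsUnit Abar.det)
    (ε : ℝ) (hε0 : 0 < ε) (hε1 : ε < 1)
    (R : Fin m → ℝ)
    (D : Matrix (Fin m) (Fin m) ℝ) (hD : D = Matrix.diagonal π)
    (θstar : Fin K → ℝ) (hθ : θstar = -(Abar⁻¹.mulVec ((Φᵀ * D).mulVec R))) :
    ∀ w : Fin K → ℝ,
      ∀ Cw : Fin m → ℝ,
        Cw = (1 / ε) • (D⁻¹ * Φ * (Φᵀ * Φ)⁻¹ * Abar).mulVec ((1 - ε) • θstar - w) →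
        (-(Abar⁻¹.mulVec ((Φᵀ * D).mulVec ((1 - ε) • R + ε • Cw))) = w) ∧
        ∃ C : Fin m → ℝ,
          -(Abar⁻¹.mulVec ((Φᵀ * D).mulVec ((1 - ε) • R + ε • C))) = w := by
  intro w Cw hCw
  have hDdet : IsUnit D.det := by
    rw [hD, Matrix.det_diagonal]
    exact (Finset.prod_pos fun s _ => hπ s).ne'.isUnit
  have hGram := isUnit_det_transpose_mul_self_of_injective_mulVec hΦ
  have hcancel : Abar⁻¹ * (Φᵀ * D) * (D⁻¹ * Φ * (Φᵀ * Φ)⁻¹ * Abar) = 1 := by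
    calc Abar⁻¹ * (Φᵀ * D) * (D⁻¹ * Φ * (Φᵀ * Φ)⁻¹ * Abar)
        = Abar⁻¹ * (Φᵀ * (D * D⁻¹) * Φ * (Φᵀ * Φ)⁻¹ * Abar) := by
          simp only [Matrix.mul_assoc]
      _ = 1 := by
          rw [Matrix.mul_nonsing_inv _ hDdet, Matrix.mul_one, Matrix.mul_nonsing_inv _ hGram,
            Matrix.one_mul, Matrix.nonsing_inv_mul _ hA]
  have hfix : -(Abar⁻¹.mulVec ((Φᵀ * D).mulVec ((1 - ε) • R + ε • Cw))) = w := by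
    have hεC : ε • Cw = (D⁻¹ * Φ * (Φᵀ * Φ)⁻¹ * Abar).mulVec ((1 - ε) • θstar - w) := by
      rw [hCw, smul_smul, mul_one_div_cancel hε0.ne', one_smul]
    have hR : Abar⁻¹.mulVec ((Φᵀ * D).mulVec R) = -θstar := by rw [hθ, neg_neg]
    rw [hεC, Matrix.mulVec_add, Matrix.mulVec_add, Matrix.mulVec_smul, Matrix.mulVec_smul, hR,
      Matrix.mulVec_mulVec, Matrix.mulVec_mulVec, hcancel, Matrix.one_mulVec]
    module
  exact ⟨hfix, Cw, hfix⟩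
end

section
/- (Performance of RUMEM.) There exists a universal constant C ≥ 1 such that the following holds. Consider the Huber-contaminated Markovian data model with corruption fraction ε, and run RUMEM on the N observations with parameters τ = ⌈log₂(6N/δ) τ_mix⌉, ε′ = ε + (32/(3n)) log(24/δ), and L = ⌈12ε′n + (256/7) log(N/δ)⌉, where n = ⌊(N−1)/τ⌋ + 1. Then for any δ ∈ (0,1), if N ≥ max{2, 4Lτ}, with probability at least 1−δ the output μ̂ of RUMEM satisfies |μ̂ − f̄| ≤ C max{ψ, ρ} ( √ε + √((τ/N) log(N/δ)) ). -/
open Matrix MeasureTheory Filter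

/-- `med` is a median of the `L` values `vals 0, …, vals (L−1)`: at least half of
the entries are `≤ med` and at least half are `≥ med`. -/
def IsMedianOf (L : ℕ) (vals : ℕ → ℝ) (med : ℝ) : Prop :=
  L ≤ 2 * ((Finset.range L).filter fun i => vals i ≤ med).card ∧
    L ≤ 2 * ((Finset.range L).filter fun i => med ≤ vals i).card

/-- The mixing quantity `d_mix(t) = sup_x D_TV(ℙ(X_{t+1} ∈ ·| X₁ = x), π)` for a
finite-state chain with transition matrix `P` and stationary distribution `π`. -/
noncomputable def dmixMat {𝒳 : Type*} [Fintype 𝒳] [DecidableEq 𝒳]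
    (P : Matrix 𝒳 𝒳 ℝ) (π : 𝒳 → ℝ) (t : ℕ) : ℝ :=
  ⨆ x, (1 / 2) * ∑ y, |(P ^ t) x y - π y|

/-- The mixing time `τ_mix = inf{t ≥ 1 : d_mix(t) ≤ 1/4}`. -/
noncomputable def tmixMat {𝒳 : Type*} [Fintype 𝒳] [DecidableEq 𝒳]
    (P : Matrix 𝒳 𝒳 ℝ) (π : 𝒳 → ℝ) : ℕ :=
  sInf {t | 1 ≤ t ∧ dmixMat P π t ≤ 1 / 4}

/-- The mean of the `i`-th bucket (of size `M`) of the sequence obtained from the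
data `y` by keeping every `τ`-th sample. -/
noncomputable def subsampledBucketMean (τ M : ℕ) (y : ℕ → ℝ) (i : ℕ) : ℝ :=
  (∑ j ∈ Finset.range M, y ((i * M + j) * τ)) / M

section Mixing

open scoped Matrix.Norms.Operator

variable {𝒳 : Type*} [Fintype 𝒳]

/-- The rank-one stochastic matrix all of whose rows equal `π`. -/
def rowConst (π : 𝒳 → ℝ) : Matrix 𝒳 𝒳 ℝ := Matrix.of fun _ y => π y

lemma mul_rowConst {A : Matrix 𝒳 𝒳 ℝ} {π : 𝒳 → ℝ} (hA : ∀ x, ∑ y, A x y = 1) :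
    A * rowConst π = rowConst π := by
  ext x y
  simp [Matrix.mul_apply, rowConst, ← Finset.sum_mul, hA]

lemma rowConst_mul {A : Matrix 𝒳 𝒳 ℝ} {π : 𝒳 → ℝ} (hA : Matrix.vecMul π A = π) :
    rowConst π * A = rowConst π := by
  ext x y
  simpa [Matrix.mul_apply, rowConst, Matrix.vecMul, dotProduct] using congrFun hA y

variable [DecidableEq 𝒳]

lemma rowConst_mul_pow {A : Matrix 𝒳 𝒳 ℝ} {π : 𝒳 → ℝ} (hA : Matrix.vecMul π A = π) (k : ℕ) :
    rowConst π * A ^ k = rowConst π := by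
  induction k with
  | zero => simp
  | succ k ih => rw [pow_succ, ← mul_assoc, ih, rowConst_mul hA]

lemma pow_mul_rowConst {A : Matrix 𝒳 𝒳 ℝ} {π : 𝒳 → ℝ} (hA : ∀ x, ∑ y, A x y = 1) (k : ℕ) :
    A ^ k * rowConst π = rowConst π := by
  induction k with
  | zero => simp
  | succ k ih => rw [pow_succ, mul_assoc, mul_rowConst hA, ih]

lemma linfty_norm_le_iff {A : Matrix 𝒳 𝒳 ℝ} {r : ℝ} (hr : 0 ≤ r) :
    ‖A‖ ≤ r ↔ ∀ x, ∑ y, |A x y| ≤ r := by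
  lift r to NNReal using hr
  rw [Matrix.linfty_opNorm_def, NNReal.coe_le_coe, Finset.sup_le_iff]
  refine ⟨fun h x => ?_, fun h x _ => ?_⟩
  · simpa [← NNReal.coe_le_coe] using h x (Finset.mem_univ x)
  · simpa [← NNReal.coe_le_coe] using h x

lemma pow_nonneg_row_sum {P : Matrix 𝒳 𝒳 ℝ} (h0 : ∀ x y, 0 ≤ P x y) (h1 : ∀ x, ∑ y, P x y = 1)
    (k : ℕ) : (∀ x y, 0 ≤ (P ^ k) x y) ∧ ∀ x, ∑ y, (P ^ k) x y = 1 := by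
  induction k with
  | zero =>
    refine ⟨fun x y => ?_, fun x => by simp [Matrix.one_apply]⟩
    rw [pow_zero, Matrix.one_apply]; positivity
  | succ k ih =>
    refine ⟨fun x y => ?_, fun x => ?_⟩
    · rw [pow_succ, Matrix.mul_apply]
      exact Finset.sum_nonneg fun z _ => mul_nonneg (ih.1 x z) (h0 z y)
    · simp_rw [pow_succ, Matrix.mul_apply]
      rw [Finset.sum_comm]
      simp [← Finset.mul_sum, h1, ih.2]

lemma norm_le_one_of_stochastic {P : Matrix 𝒳 𝒳 ℝ} (h0 : ∀ x y, 0 ≤ P x y)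
    (h1 : ∀ x, ∑ y, P x y = 1) : ‖P‖ ≤ 1 := by
  rw [linfty_norm_le_iff zero_le_one]
  intro x
  simp [abs_of_nonneg (h0 _ _), h1]

lemma exists_norm_pow_sub_rowConst_lt [Nonempty 𝒳] {P : Matrix 𝒳 𝒳 ℝ} (h0 : ∀ x y, 0 ≤ P x y)
    (h1 : ∀ x, ∑ y, P x y = 1) (hk : ∃ k : ℕ, ∀ x y, 0 < (P ^ k) x y)
    {π : 𝒳 → ℝ} (hπ : ∀ x, 0 < π x) (hπ1 : ∑ x, π x = 1) (hst : Matrix.vecMul π P = π)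
    {η : ℝ} (hη : 0 < η) : ∃ t : ℕ, 1 ≤ t ∧ ‖P ^ t - rowConst π‖ < η := by
  obtain ⟨k, hk⟩ := hk
  set Q := P ^ (k + 1) with hQ
  obtain ⟨q0, q1⟩ := pow_nonneg_row_sum h0 h1 (k + 1)
  have hQpos : ∀ x y, 0 < Q x y := by
    intro x y
    rw [hQ, pow_succ', Matrix.mul_apply]
    have hne : ∃ z, 0 < P x z := by
      by_contra! h
      have := h1 x
      have h2 : ∑ y, P x y ≤ 0 := Finset.sum_nonpos fun z _ => h z
      linarith
    obtain ⟨z, hz⟩ := hne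
    exact Finset.sum_pos' (fun z _ => mul_nonneg (h0 x z) (hk z y).le)
      ⟨z, Finset.mem_univ z, mul_pos hz (hk z y)⟩
  obtain ⟨⟨x₀, y₀⟩, hmin⟩ := Finite.exists_min (fun p : 𝒳 × 𝒳 => Q p.1 p.2)
  set c := Q x₀ y₀
  have hc : 0 < c := hQpos _ _
  have hπle : ∀ y, π y ≤ 1 := fun y => hπ1 ▸
    Finset.single_le_sum (fun z _ => (hπ z).le) (Finset.mem_univ y)
  have hcQ : ∀ x y, 0 ≤ Q x y - c * π y := fun x y => by
    have := hmin (x, y)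
    nlinarith [hπle y, hπ y]
  have hrow : ∀ x, ∑ y, (Q x y - c * π y) = 1 - c := fun x => by
    rw [Finset.sum_sub_distrib, ← Finset.mul_sum, hπ1, q1 x, mul_one]
  have hc1 : 0 ≤ 1 - c := hrow x₀ ▸ Finset.sum_nonneg fun y _ => hcQ x₀ y
  have hnorm : ‖Q - c • rowConst π‖ ≤ 1 - c := by
    rw [linfty_norm_le_iff hc1]
    intro x
    simp only [rowConst, Matrix.sub_apply, Matrix.smul_apply, Matrix.of_apply, smul_eq_mul]
    rw [Finset.sum_congr rfl fun y _ => abs_of_nonneg (hcQ x y), hrow]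
  have hidem : rowConst π * rowConst π = rowConst π := mul_rowConst (by simpa [rowConst] using hπ1)
  have hid : ∀ m : ℕ, (Q - rowConst π) * (Q - c • rowConst π) ^ m = Q ^ (m + 1) - rowConst π := by
    intro m
    induction m with
    | zero => simp
    | succ m ih =>
      have e1 : Q ^ (m + 1) * rowConst π = rowConst π := by
        rw [hQ, ← pow_mul]; exact pow_mul_rowConst h1 _
      have e2 : rowConst π * Q = rowConst π := rowConst_mul_pow hst _
      rw [pow_succ, ← mul_assoc, ih, sub_mul, mul_sub, mul_sub, ← pow_succ, mul_smul_comm,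
        mul_smul_comm, e1, e2, hidem]
      abel
  obtain ⟨m, hm⟩ := exists_pow_lt_of_lt_one (div_pos hη two_pos) (by linarith : 1 - c < 1)
  refine ⟨(k + 1) * (m + 1), by nlinarith, ?_⟩
  rw [pow_mul, ← hQ, ← hid]
  have hQπ : ‖Q - rowConst π‖ ≤ 2 := by
    refine (norm_sub_le _ _).trans ?_
    have := norm_le_one_of_stochastic q0 q1
    have h3 : ‖rowConst π‖ ≤ 1 := norm_le_one_of_stochastic (fun _ y => (hπ y).le)
      (by simpa [rowConst] using hπ1)
    rw [← hQ] at this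
    linarith
  have hpow : ‖(Q - c • rowConst π) ^ m‖ ≤ (1 - c) ^ m :=
    (norm_pow_le _ m).trans (pow_le_pow_left₀ (norm_nonneg _) hnorm m)
  calc _ ≤ ‖Q - rowConst π‖ * ‖(Q - c • rowConst π) ^ m‖ := norm_mul_le _ _
    _ ≤ 2 * (1 - c) ^ m := by gcongr
    _ < η := by linarith

lemma norm_pow_sub_rowConst_le_of_dmixMat_le {P : Matrix 𝒳 𝒳 ℝ} {π : 𝒳 → ℝ} {t : ℕ} {d : ℝ}
    (hd : 0 ≤ d) (h : dmixMat P π t ≤ d) : ‖P ^ t - rowConst π‖ ≤ 2 * d := by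
  rw [linfty_norm_le_iff (by positivity)]
  intro x
  have hx : (1 / 2) * ∑ y, |(P ^ t) x y - π y| ≤ d :=
    (le_ciSup (f := fun x => (1 / 2) * ∑ y, |(P ^ t) x y - π y|)
      (Set.finite_range _).bddAbove x).trans h
  simp only [rowConst, Matrix.sub_apply, Matrix.of_apply]
  linarith

/-- The mixing time is positive, and the chain forgets its initial state geometrically fast on
the scale of the mixing time. -/
lemma tmixMat_pos_and_sum_abs_le [Nonempty 𝒳] {P : Matrix 𝒳 𝒳 ℝ} (h0 : ∀ x y, 0 ≤ P x y)
    (h1 : ∀ x, ∑ y, P x y = 1) (hk : ∃ k : ℕ, ∀ x y, 0 < (P ^ k) x y)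
    {π : 𝒳 → ℝ} (hπ : ∀ x, 0 < π x) (hπ1 : ∑ x, π x = 1) (hst : Matrix.vecMul π P = π) :
    1 ≤ tmixMat P π ∧ ∀ k τ : ℕ, 1 ≤ k → k * tmixMat P π ≤ τ →
      ∀ x, ∑ y, |(P ^ τ) x y - π y| ≤ (1 / 2) ^ k := by
  have hne : {t | 1 ≤ t ∧ dmixMat P π t ≤ 1 / 4}.Nonempty := by
    obtain ⟨t, ht, h⟩ := exists_norm_pow_sub_rowConst_lt h0 h1 hk hπ hπ1 hst
      (by norm_num : (0 : ℝ) < 1 / 2)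
    refine ⟨t, ht, ciSup_le fun x => ?_⟩
    have := (linfty_norm_le_iff (by norm_num)).1 h.le x
    simp only [rowConst, Matrix.sub_apply, Matrix.of_apply] at this
    linarith
  obtain ⟨ht, hd⟩ := Nat.sInf_mem hne
  refine ⟨ht, fun k τ hk1 hkτ x => ?_⟩
  set t := tmixMat P π with htdef
  have hidem : rowConst π * rowConst π = rowConst π := mul_rowConst (by simpa [rowConst] using hπ1)
  have hpow : ∀ m : ℕ, (P ^ t - rowConst π) ^ (m + 1) = P ^ (t * (m + 1)) - rowConst π := by
    intro m
    induction m with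
    | zero => simp
    | succ m ih =>
      rw [pow_succ, ih, sub_mul, mul_sub, mul_sub, ← pow_add, pow_mul_rowConst h1,
        rowConst_mul_pow hst, hidem]
      simp [mul_add]
  have hn : ‖P ^ t - rowConst π‖ ≤ 1 / 2 := by
    have := norm_pow_sub_rowConst_le_of_dmixMat_le (by norm_num) hd
    rw [htdef]
    exact this.trans (by norm_num)
  obtain ⟨m, rfl⟩ : ∃ m, k = m + 1 := ⟨k - 1, by omega⟩
  have hfac : P ^ τ - rowConst π = P ^ (τ - (m + 1) * t) * (P ^ t - rowConst π) ^ (m + 1) := by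
    rw [hpow, mul_sub, ← pow_add, pow_mul_rowConst h1]
    congr 2
    rw [mul_comm t]; omega
  have key : ‖P ^ τ - rowConst π‖ ≤ (1 / 2) ^ (m + 1) := by
    obtain ⟨q0, q1⟩ := pow_nonneg_row_sum h0 h1 (τ - (m + 1) * t)
    rw [hfac]
    calc _ ≤ ‖P ^ (τ - (m + 1) * t)‖ * ‖(P ^ t - rowConst π) ^ (m + 1)‖ := norm_mul_le _ _
      _ ≤ 1 * (1 / 2) ^ (m + 1) := by
        gcongr
        · exact norm_le_one_of_stochastic q0 q1
        · exact (norm_pow_le _ _).trans (pow_le_pow_left₀ (norm_nonneg _) hn _)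
      _ = _ := one_mul _
  exact (linfty_norm_le_iff (by positivity)).1 key x

end Mixing

section Concentration

variable {Ω : Type*} {mΩ : MeasurableSpace Ω}

/-- Chebyshev-type tail bound for sums of real observations whose conditional laws given the past
are within `η` of a fixed centred law `ν`, in the sense of the hypothesis `hstep`. -/
lemma measure_inter_abs_sum_gt_le {Pr : Measure Ω} {𝒢 : ℕ → MeasurableSpace Ω}
    (hmono : Monotone 𝒢) (hle : ∀ m, 𝒢 m ≤ mΩ) {Y : ℕ → Ω → ℝ}
    (hY : ∀ m, Measurable[𝒢 (m + 1)] (Y m)) {ν : Measure ℝ} [IsProbabilityMeasure ν]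
    {η v a : ℝ} (hη : 0 ≤ η) (hv : 0 ≤ v) (ha : 0 < a)
    (hν : Integrable (fun y => y) ν) (hν2 : Integrable (fun y => y ^ 2) ν)
    (hmean : ∫ y, y ∂ν = 0) (hvar : ∫ y, y ^ 2 ∂ν ≤ v)
    (hstep : ∀ (m : ℕ) (G : Set Ω) (S : Ω → ℝ) (g : ℝ → ENNReal), MeasurableSet[𝒢 m] G →
      Measurable[𝒢 m] S → Measurable g → (∀ s, g s ≤ 1) →
      ∫⁻ ω in G, g (S ω + Y m ω) ∂Pr ≤
        ∫⁻ ω in G, min 1 (∫⁻ y, g (S ω + y) ∂ν + ENNReal.ofReal η) ∂Pr)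
    (r : ℕ) : ∀ (m : ℕ) (G : Set Ω) (S : Ω → ℝ), MeasurableSet[𝒢 m] G → Measurable[𝒢 m] S →
      Pr (G ∩ {ω | a < |S ω + ∑ j ∈ Finset.range r, Y (m + j) ω|}) ≤
        ∫⁻ ω in G, min 1 (ENNReal.ofReal (r * η + (S ω ^ 2 + r * v) / a ^ 2)) ∂Pr := by
  induction r with
  | zero =>
    intro m G S hG hS
    have hS' : Measurable S := hS.mono (hle m) le_rfl
    have hE : MeasurableSet {ω | a < |S ω|} := measurableSet_lt measurable_const hS'.abs
    simp only [Finset.range_zero, Finset.sum_empty, add_zero]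
    rw [Set.inter_comm, ← Measure.restrict_apply hE, ← lintegral_indicator_one hE]
    refine lintegral_mono fun ω => ?_
    by_cases hω : a < |S ω|
    · rw [Set.indicator_of_mem (by exact hω)]
      refine le_min le_rfl ?_
      rw [Pi.one_apply, ← ENNReal.ofReal_one]
      refine ENNReal.ofReal_le_ofReal ?_
      have : a ^ 2 ≤ S ω ^ 2 := by
        rw [← sq_abs (S ω)]; exact pow_le_pow_left₀ ha.le hω.le 2
      simpa using (one_le_div (by positivity)).2 this
    · rw [Set.indicator_of_notMem (by exact hω)]
      exact zero_le
  | succ r ih =>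
    intro m G S hG hS
    have hG' : MeasurableSet[𝒢 (m + 1)] G := hmono (Nat.le_succ m) G hG
    have hS' : Measurable[𝒢 (m + 1)] S := hS.mono (hmono (Nat.le_succ m)) le_rfl
    have h1 := ih (m + 1) G (fun ω => S ω + Y m ω) hG' (hS'.add (hY m))
    have hset : ∀ ω, S ω + Y m ω + ∑ j ∈ Finset.range r, Y (m + 1 + j) ω =
        S ω + ∑ j ∈ Finset.range (r + 1), Y (m + j) ω := by
      intro ω
      rw [Finset.sum_range_succ']
      simp only [add_zero]
      have : ∀ j, m + 1 + j = m + (j + 1) := fun j => by ring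
      simp only [this]
      ring
    simp only [hset] at h1
    refine h1.trans ((hstep m G S
      (fun s => min 1 (ENNReal.ofReal (r * η + (s ^ 2 + r * v) / a ^ 2))) hG hS
      (by fun_prop) (fun s => min_le_left _ _)).trans ?_)
    refine lintegral_mono fun ω => min_le_min le_rfl ?_
    set s := S ω
    have hint : Integrable (fun y => r * η + ((s + y) ^ 2 + r * v) / a ^ 2) ν := by
      have : (fun y : ℝ => r * η + ((s + y) ^ 2 + r * v) / a ^ 2) =
          fun y => (r * η + (s ^ 2 + r * v) / a ^ 2) + ((2 * s / a ^ 2) * y + y ^ 2 / a ^ 2) := by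
        ext y; ring
      rw [this]
      exact (integrable_const _).add ((hν.const_mul _).add (hν2.div_const _))
    have hval : ∫ y, (r * η + ((s + y) ^ 2 + r * v) / a ^ 2) ∂ν =
        r * η + (s ^ 2 + r * v) / a ^ 2 + (∫ y, y ^ 2 ∂ν) / a ^ 2 := by
      have : (fun y : ℝ => r * η + ((s + y) ^ 2 + r * v) / a ^ 2) =
          fun y => (r * η + (s ^ 2 + r * v) / a ^ 2) + ((2 * s / a ^ 2) * y + y ^ 2 / a ^ 2) := by
        ext y; ring
      have hi : Integrable (fun y => (2 * s / a ^ 2) * y + y ^ 2 / a ^ 2) ν :=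
        (hν.const_mul _).add (hν2.div_const _)
      rw [this, integral_add (integrable_const _) hi,
        integral_add (hν.const_mul _) (hν2.div_const _), integral_const_mul, hmean,
        integral_div]
      simp
    calc _ ≤ ∫⁻ y, ENNReal.ofReal (r * η + ((s + y) ^ 2 + r * v) / a ^ 2) ∂ν +
          ENNReal.ofReal η := by
          gcongr
          exact min_le_right _ _
      _ = ENNReal.ofReal (r * η + (s ^ 2 + r * v) / a ^ 2 + (∫ y, y ^ 2 ∂ν) / a ^ 2) +
          ENNReal.ofReal η := by
          rw [← ofReal_integral_eq_lintegral_ofReal hint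
            (Eventually.of_forall fun y => by positivity), hval]
      _ = ENNReal.ofReal (r * η + (s ^ 2 + r * v) / a ^ 2 + (∫ y, y ^ 2 ∂ν) / a ^ 2 + η) := by
          rw [← ENNReal.ofReal_add _ hη]
          have : 0 ≤ ∫ y, y ^ 2 ∂ν := integral_nonneg fun y => sq_nonneg y
          positivity
      _ ≤ _ := by
          refine ENNReal.ofReal_le_ofReal ?_
          have : (∫ y, y ^ 2 ∂ν) / a ^ 2 ≤ v / a ^ 2 := by gcongr
          push_cast
          have e : (s ^ 2 + (r + 1) * v) / a ^ 2 = (s ^ 2 + r * v) / a ^ 2 + v / a ^ 2 := by ring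
          rw [e]
          linarith

/-- If each event `b i` has conditional probability at most `p` given the past, then all the events
indexed by `S` occur with probability at most `p ^ #S`. -/
lemma measure_inter_events_le {Pr : Measure Ω} [IsProbabilityMeasure Pr]
    {ℋ : ℕ → MeasurableSpace Ω} (hmono : Monotone ℋ) {b : ℕ → Set Ω}
    (hb : ∀ i, MeasurableSet[ℋ (i + 1)] (b i)) {p : ENNReal}
    (hp : ∀ i G, MeasurableSet[ℋ i] G → Pr (G ∩ b i) ≤ Pr G * p) (l : ℕ) :
    ∀ S ⊆ Finset.range l, MeasurableSet[ℋ l] (⋂ i ∈ S, b i) ∧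
      Pr (⋂ i ∈ S, b i) ≤ p ^ S.card := by
  induction l with
  | zero =>
    intro S hS
    obtain rfl : S = ∅ := by simpa using hS
    simp
  | succ l ih =>
    intro S hS
    by_cases hl : l ∈ S
    · have hsub : S.erase l ⊆ Finset.range l := fun i hi => by
        have h1 := Finset.mem_range.1 (hS (Finset.mem_of_mem_erase hi))
        have h2 := Finset.ne_of_mem_erase hi
        exact Finset.mem_range.2 (by omega)
      obtain ⟨hm, hle⟩ := ih _ hsub
      have hins : ⋂ i ∈ S, b i = (⋂ i ∈ S.erase l, b i) ∩ b l := by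
        conv_lhs => rw [← Finset.insert_erase hl]
        rw [Finset.set_biInter_insert, Set.inter_comm]
      rw [hins, ← Finset.card_erase_add_one hl, pow_succ]
      exact ⟨(hmono (Nat.le_succ l) _ hm).inter (hb l), (hp l _ hm).trans (by gcongr)⟩
    · have hsub : S ⊆ Finset.range l := fun i hi => by
        have h1 := Finset.mem_range.1 (hS hi)
        have h2 : i ≠ l := fun h => hl (h ▸ hi)
        exact Finset.mem_range.2 (by omega)
      obtain ⟨hm, hle⟩ := ih _ hsub
      exact ⟨hmono (Nat.le_succ l) _ hm, hle⟩

open Classical in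
lemma measure_half_events_le {Pr : Measure Ω} [IsProbabilityMeasure Pr]
    {ℋ : ℕ → MeasurableSpace Ω} (hmono : Monotone ℋ) {b : ℕ → Set Ω}
    (hb : ∀ i, MeasurableSet[ℋ (i + 1)] (b i)) {c : ENNReal} (hc : c ≤ 1)
    (hp : ∀ i G, MeasurableSet[ℋ i] G → Pr (G ∩ b i) ≤ Pr G * c ^ 2) (L : ℕ) :
    Pr {ω | L ≤ 2 * ((Finset.range L).filter fun i => ω ∈ b i).card} ≤ (2 * c) ^ L := by
  have hsub : {ω | L ≤ 2 * ((Finset.range L).filter fun i => ω ∈ b i).card} ⊆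
      ⋃ S ∈ (Finset.range L).powerset.filter fun S => L ≤ 2 * S.card, ⋂ i ∈ S, b i := by
    intro ω hω
    simp only [Set.mem_iUnion]
    refine ⟨(Finset.range L).filter fun i => ω ∈ b i, ?_, ?_⟩
    · simpa [Finset.filter_subset] using hω
    · simp
  refine (measure_mono hsub).trans ((measure_biUnion_finset_le _ _).trans ?_)
  calc _ ≤ ∑ S ∈ (Finset.range L).powerset.filter (fun S => L ≤ 2 * S.card), c ^ L := by
        refine Finset.sum_le_sum fun S hS => ?_
        rw [Finset.mem_filter, Finset.mem_powerset] at hS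
        refine (measure_inter_events_le hmono hb hp L S hS.1).2.trans ?_
        rw [← pow_mul]
        exact pow_le_pow_right_of_le_one' hc hS.2
    _ ≤ ∑ S ∈ (Finset.range L).powerset, c ^ L :=
        Finset.sum_le_sum_of_subset (Finset.filter_subset _ _)
    _ = _ := by simp [mul_pow]

end Concentration

section MarkovObservations

variable {Ω : Type*} {𝒳 : Type*} [MeasurableSpace 𝒳]

/-- The first `k` states and the first `k` observations. -/
def pathMap (X : ℕ → Ω → 𝒳) (Y : ℕ → Ω → ℝ) (k : ℕ) (ω : Ω) : (Fin k → 𝒳) × (Fin k → ℝ) :=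
  (fun j => X j ω, fun j => Y j ω)

/-- The σ-algebra generated by the first `k` states and the first `k` observations. -/
abbrev pathSigma (X : ℕ → Ω → 𝒳) (Y : ℕ → Ω → ℝ) (k : ℕ) : MeasurableSpace Ω :=
  MeasurableSpace.comap (pathMap X Y k) inferInstance

lemma measurable_pathSigma_state (X : ℕ → Ω → 𝒳) (Y : ℕ → Ω → ℝ) {j k : ℕ} (h : j < k) :
    Measurable[pathSigma X Y k] (X j) :=
  ((measurable_pi_apply (⟨j, h⟩ : Fin k)).comp measurable_fst).comp
    (comap_measurable (pathMap X Y k))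

lemma measurable_pathSigma_obs (X : ℕ → Ω → 𝒳) (Y : ℕ → Ω → ℝ) {j k : ℕ} (h : j < k) :
    Measurable[pathSigma X Y k] (Y j) :=
  ((measurable_pi_apply (⟨j, h⟩ : Fin k)).comp measurable_snd).comp
    (comap_measurable (pathMap X Y k))

lemma pathSigma_mono (X : ℕ → Ω → 𝒳) (Y : ℕ → Ω → ℝ) : Monotone (pathSigma X Y) := by
  rintro k l hkl _ ⟨E, hE, rfl⟩
  let r : (Fin l → 𝒳) × (Fin l → ℝ) → (Fin k → 𝒳) × (Fin k → ℝ) := fun q =>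
    (fun j => q.1 (Fin.castLE hkl j), fun j => q.2 (Fin.castLE hkl j))
  have hr : Measurable r := by fun_prop
  exact ⟨r ⁻¹' E, hr hE, rfl⟩

lemma measurable_pathMap [MeasurableSpace Ω] {X : ℕ → Ω → 𝒳} {Y : ℕ → Ω → ℝ}
    (hX : ∀ k, Measurable (X k)) (hY : ∀ k, Measurable (Y k)) (k : ℕ) :
    Measurable (pathMap X Y k) :=
  Measurable.prodMk (f := fun ω (j : Fin k) => X j ω) (g := fun ω (j : Fin k) => Y j ω)
    (measurable_pi_lambda _ fun j => hX j) (measurable_pi_lambda _ fun j => hY j)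

lemma pathSigma_le [mΩ : MeasurableSpace Ω] {X : ℕ → Ω → 𝒳} {Y : ℕ → Ω → ℝ}
    (hX : ∀ k, Measurable (X k)) (hY : ∀ k, Measurable (Y k)) (k : ℕ) : pathSigma X Y k ≤ mΩ :=
  (measurable_pathMap hX hY k).comap_le

lemma measure_eq_sum_inter_preimage {ι : Type*} [Fintype ι] [MeasurableSpace Ω] (μ : Measure Ω)
    {g : Ω → ι} (hg : ∀ i, MeasurableSet (g ⁻¹' {i})) (H : Set Ω) :
    μ H = ∑ i, μ (H ∩ g ⁻¹' {i}) := by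
  have h := sum_measure_preimage_singleton (μ := μ.restrict H) Finset.univ (f := g)
    (fun i _ => hg i)
  simp only [Finset.coe_univ, Set.preimage_univ, Measure.restrict_apply_univ] at h
  rw [← h]
  exact Finset.sum_congr rfl fun i _ => by rw [Measure.restrict_apply (hg i), Set.inter_comm]

/-- The joint law of a Markov chain with initial weights `w`, transition weights `p`, and
conditionally independent real observations with emission laws `μ k x`, given on cylinders. -/
def HasCylinderLaw {Ω 𝒳 : Type*} [MeasurableSpace Ω] (Pr : Measure Ω) (w : 𝒳 → ENNReal) (p : 𝒳 → 𝒳 → ENNReal)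
    (μ : ℕ → 𝒳 → Measure ℝ) (X : ℕ → Ω → 𝒳) (Y : ℕ → Ω → ℝ) : Prop :=
  ∀ (n : ℕ) (f : Fin (n + 1) → 𝒳) (B : Fin (n + 1) → Set ℝ), (∀ k, MeasurableSet (B k)) →
    Pr {ω | ∀ k : Fin (n + 1), X k ω = f k ∧ Y k ω ∈ B k} =
      w (f 0) * (∏ k : Fin n, p (f k.castSucc) (f k.succ)) * ∏ k : Fin (n + 1), μ k (f k) (B k)

lemma HasCylinderLaw.succ {Ω 𝒳 : Type*} [MeasurableSpace Ω] {Pr : Measure Ω} {w : 𝒳 → ENNReal}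
    {p : 𝒳 → 𝒳 → ENNReal} {μ : ℕ → 𝒳 → Measure ℝ} {X : ℕ → Ω → 𝒳} {Y : ℕ → Ω → ℝ}
    (h : HasCylinderLaw Pr w p μ X Y) {k : ℕ} (f : Fin (k + 1) → 𝒳) (y : 𝒳)
    (C : Fin (k + 1) → Set ℝ) (hC : ∀ j, MeasurableSet (C j)) {B : Set ℝ} (hB : MeasurableSet B) :
    Pr ({ω | ∀ j : Fin (k + 1), X j ω = f j ∧ Y j ω ∈ C j} ∩
        {ω | X (k + 1) ω = y ∧ Y (k + 1) ω ∈ B}) =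
      Pr {ω | ∀ j : Fin (k + 1), X j ω = f j ∧ Y j ω ∈ C j} *
        (p (f (Fin.last k)) y * μ (k + 1) y B) := by
  have h1 := h (k + 1) (Fin.snoc (α := fun _ => 𝒳) f y) (Fin.snoc (α := fun _ => Set ℝ) C B) (by
    intro j
    refine Fin.lastCases ?_ (fun j => ?_) j
    · simpa using hB
    · simpa using hC j)
  have hset : {ω | ∀ j : Fin (k + 1), X j ω = f j ∧ Y j ω ∈ C j} ∩
        {ω | X (k + 1) ω = y ∧ Y (k + 1) ω ∈ B} =
      {ω | ∀ j : Fin (k + 1 + 1), X j ω = Fin.snoc (α := fun _ => 𝒳) f y j ∧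
        Y j ω ∈ Fin.snoc (α := fun _ => Set ℝ) C B j} := by
    ext ω
    simp [Fin.forall_fin_succ']
  have h0 : Fin.snoc (α := fun _ => 𝒳) f y 0 = f 0 := by
    exact Fin.snoc_castSucc (α := fun _ => 𝒳) y f 0
  rw [hset, h1, h k f C hC, Fin.prod_univ_castSucc, Fin.prod_univ_castSucc (n := k + 1), h0]
  simp only [Fin.succ_castSucc, Fin.snoc_castSucc, Fin.succ_last, Fin.snoc_last, Fin.val_castSucc,
    Fin.val_last]
  ring

variable [MeasurableSpace Ω] [MeasurableSingletonClass 𝒳] {Pr : Measure Ω} {w : 𝒳 → ENNReal}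
  {μ : ℕ → 𝒳 → Measure ℝ} {X : ℕ → Ω → 𝒳} {Y : ℕ → Ω → ℝ}

/-- The Markov property, one step ahead. -/
lemma HasCylinderLaw.measure_inter_succ [Finite 𝒳] [IsFiniteMeasure Pr]
    [∀ k x, IsProbabilityMeasure (μ k x)] {p : 𝒳 → 𝒳 → ENNReal} (h : HasCylinderLaw Pr w p μ X Y)
    (hX : ∀ k, Measurable (X k)) (hY : ∀ k, Measurable (Y k)) (hp : ∀ x y, p x y ≠ ⊤) {k : ℕ}
    {G : Set Ω} (hG : MeasurableSet[pathSigma X Y (k + 1)] G) (x y : 𝒳) {B : Set ℝ}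
    (hB : MeasurableSet B) :
    Pr (G ∩ {ω | X k ω = x} ∩ {ω | X (k + 1) ω = y ∧ Y (k + 1) ω ∈ B}) =
      Pr (G ∩ {ω | X k ω = x}) * (p x y * μ (k + 1) y B) := by
  have := Fintype.ofFinite 𝒳
  obtain ⟨E, hE, rfl⟩ := hG
  set g : Ω → (Fin (k + 1) → 𝒳) := fun ω j => X j ω with hgdef
  set V : Ω → (Fin (k + 1) → ℝ) := fun ω j => Y j ω with hVdef
  have hV : Measurable V := measurable_pi_lambda _ fun j => hY j
  have hgm : Measurable g := measurable_pi_lambda _ fun j => hX j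
  have hg : ∀ f, MeasurableSet (g ⁻¹' {f}) := fun f => hgm (measurableSet_singleton f)
  set N : Set Ω := {ω | X (k + 1) ω = y ∧ Y (k + 1) ω ∈ B} with hN
  have hNm : MeasurableSet N :=
    (hX (k + 1) (measurableSet_singleton y)).inter (hY (k + 1) hB)
  rw [measure_eq_sum_inter_preimage Pr hg (_ ∩ N), measure_eq_sum_inter_preimage Pr hg (_ ∩ _),
    Finset.sum_mul]
  refine Finset.sum_congr rfl fun f _ => ?_
  by_cases hfx : f (Fin.last k) = x
  swap
  · have hempty : {ω | X k ω = x} ∩ g ⁻¹' {f} = ∅ := by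
      ext ω
      simp only [Set.mem_inter_iff, Set.mem_ofPred_eq, Set.mem_preimage, Set.mem_singleton_iff,
        Set.mem_empty_iff_false, iff_false, not_and]
      rintro h1 rfl
      exact hfx (by simpa [hgdef] using h1)
    rw [Set.inter_right_comm, Set.inter_assoc _ _ (g ⁻¹' {f}), hempty]
    simp
  subst hfx
  have hlast : g ⁻¹' {f} ⊆ {ω | X k ω = f (Fin.last k)} := by
    rintro ω rfl
    simp [hgdef]
  have hsec : ∀ T : Set Ω, pathMap X Y (k + 1) ⁻¹' E ∩ {ω | X k ω = f (Fin.last k)} ∩ T ∩ g ⁻¹' {f} =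
      V ⁻¹' {v | (f, v) ∈ E} ∩ (g ⁻¹' {f} ∩ T) := by
    intro T
    ext ω
    constructor
    · rintro ⟨⟨⟨h1, -⟩, h2⟩, rfl⟩
      exact ⟨h1, rfl, h2⟩
    · rintro ⟨h1, h2, h3⟩
      refine ⟨⟨⟨?_, hlast h2⟩, h3⟩, h2⟩
      obtain rfl : g ω = f := h2
      exact h1
  have hEf : MeasurableSet {v | (f, v) ∈ E} := measurable_prodMk_left hE
  have hsec' := hsec Set.univ
  rw [Set.inter_univ, Set.inter_univ] at hsec'
  rw [hsec N, hsec']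
  set c := p (f (Fin.last k)) y * μ (k + 1) y B with hc
  have hctop : c ≠ ⊤ := ENNReal.mul_ne_top (hp _ _) (measure_ne_top _ _)
  have hmeas : (Pr.restrict (g ⁻¹' {f} ∩ N)).map V = c.toNNReal • (Pr.restrict (g ⁻¹' {f})).map V := by
    have hbox : ∀ C : Fin (k + 1) → Set ℝ, (∀ j, MeasurableSet (C j)) →
        (Pr.restrict (g ⁻¹' {f} ∩ N)).map V (Set.univ.pi C) =
          (c.toNNReal • (Pr.restrict (g ⁻¹' {f})).map V) (Set.univ.pi C) := by
      intro C hC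
      have hCm : MeasurableSet (Set.univ.pi C) := MeasurableSet.univ_pi hC
      have e : V ⁻¹' Set.univ.pi C ∩ g ⁻¹' {f} =
          {ω | ∀ j : Fin (k + 1), X j ω = f j ∧ Y j ω ∈ C j} := by
        ext ω
        simp [hgdef, hVdef, funext_iff, forall_and, and_comm]
      rw [Measure.smul_apply, Measure.map_apply hV hCm, Measure.map_apply hV hCm,
        Measure.restrict_apply (hV hCm), Measure.restrict_apply (hV hCm), ← Set.inter_assoc, e,
        h.succ f y C hC hB, ENNReal.smul_def, ENNReal.coe_toNNReal hctop, smul_eq_mul, mul_comm]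
    refine ext_of_generate_finite _ generateFrom_pi.symm isPiSystem_pi ?_ ?_
    · rintro _ ⟨C, hC, rfl⟩
      exact hbox C fun j => hC j (Set.mem_univ j)
    · simpa using hbox (fun _ => Set.univ) fun _ => MeasurableSet.univ
  have := congrArg (fun m => m {v | (f, v) ∈ E}) hmeas
  simp only [Measure.smul_apply] at this
  rw [Measure.map_apply hV hEf, Measure.map_apply hV hEf, Measure.restrict_apply (hV hEf),
    Measure.restrict_apply (hV hEf), ENNReal.smul_def, ENNReal.coe_toNNReal hctop,
    smul_eq_mul] at this
  rw [this, mul_comm]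

/-- The Markov property, `s + 1` steps ahead. -/
lemma HasCylinderLaw.measure_inter_add [Fintype 𝒳] [DecidableEq 𝒳] [IsFiniteMeasure Pr]
    [∀ k x, IsProbabilityMeasure (μ k x)] {P : Matrix 𝒳 𝒳 ℝ} (hP : ∀ s x y, 0 ≤ (P ^ s) x y)
    (h : HasCylinderLaw Pr w (fun x y => ENNReal.ofReal (P x y)) μ X Y)
    (hX : ∀ k, Measurable (X k)) (hY : ∀ k, Measurable (Y k)) {k : ℕ}
    {G : Set Ω} (hG : MeasurableSet[pathSigma X Y (k + 1)] G) (x : 𝒳) (s : ℕ) :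
    ∀ (y : 𝒳) {B : Set ℝ}, MeasurableSet B →
    Pr (G ∩ {ω | X k ω = x} ∩ {ω | X (k + s + 1) ω = y ∧ Y (k + s + 1) ω ∈ B}) =
      Pr (G ∩ {ω | X k ω = x}) * (ENNReal.ofReal ((P ^ (s + 1)) x y) * μ (k + s + 1) y B) := by
  induction s with
  | zero =>
    intro y B hB
    simpa using h.measure_inter_succ hX hY (fun _ _ => ENNReal.ofReal_ne_top) hG x y hB
  | succ s ih =>
    intro y B hB
    have hG' : MeasurableSet[pathSigma X Y (k + s + 1 + 1)] (G ∩ {ω | X k ω = x}) :=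
      (pathSigma_mono X Y (by omega : k + 1 ≤ k + s + 1 + 1) _ hG).inter
        (measurable_pathSigma_state X Y (by omega) (measurableSet_singleton x))
    have hm : ∀ z, MeasurableSet (X (k + s + 1) ⁻¹' {z}) := fun z =>
      hX _ (measurableSet_singleton z)
    rw [measure_eq_sum_inter_preimage Pr hm, pow_succ _ (s + 1), Matrix.mul_apply,
      ENNReal.ofReal_sum_of_nonneg
        (fun z _ => mul_nonneg (hP _ _ _) (by simpa using hP 1 z y)),
      Finset.sum_mul, Finset.mul_sum]
    refine Finset.sum_congr rfl fun z _ => ?_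
    have h1 := h.measure_inter_succ hX hY (fun _ _ => ENNReal.ofReal_ne_top) hG' z y hB
    have h2 := ih z MeasurableSet.univ
    simp only [Set.mem_univ, and_true, measure_univ, mul_one] at h2
    rw [h2] at h1
    rw [Set.inter_right_comm, ENNReal.ofReal_mul (hP _ _ _)]
    refine Eq.trans ?_ (h1.trans ?_)
    · rfl
    · rw [mul_assoc, mul_assoc]; rfl

lemma HasCylinderLaw.measure_zero [Fintype 𝒳] {p : 𝒳 → 𝒳 → ENNReal} (h : HasCylinderLaw Pr w p μ X Y)
    (hX : ∀ k, Measurable (X k)) {B : Set ℝ} (hB : MeasurableSet B) :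
    Pr {ω | Y 0 ω ∈ B} = ∑ y, w y * μ 0 y B := by
  rw [measure_eq_sum_inter_preimage Pr fun y => hX 0 (measurableSet_singleton y)]
  refine Finset.sum_congr rfl fun y _ => ?_
  have := h 0 (fun _ => y) (fun _ => B) fun _ => hB
  simp only [Finset.univ_eq_empty, Finset.prod_empty, mul_one] at this
  refine Eq.trans ?_ (this.trans ?_)
  · congr 1
    ext ω
    simp [and_comm]
  · rw [Fin.prod_univ_one]
    rfl

end MarkovObservations

/-- If, given the label `T` and the past `m`, the observation `Z` has a law close to `ν`, then `Z`
may be replaced by an independent sample from `ν` at a cost of `η`. -/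
lemma setLIntegral_add_le_of_label {Ω 𝒳 : Type*} [Fintype 𝒳] [MeasurableSpace 𝒳]
    [MeasurableSingletonClass 𝒳] {m mΩ : MeasurableSpace Ω} {Pr : Measure Ω} [IsFiniteMeasure Pr]
    (hm : m ≤ mΩ) {T : Ω → 𝒳} {Z : Ω → ℝ}
    (hT : Measurable[m] T) (hZ : Measurable Z) {K : 𝒳 → Measure ℝ} [∀ x, IsProbabilityMeasure (K x)]
    (hK : ∀ G, MeasurableSet[m] G → ∀ x B, MeasurableSet B →
      Pr (G ∩ {ω | T ω = x} ∩ {ω | Z ω ∈ B}) = Pr (G ∩ {ω | T ω = x}) * K x B)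
    {ν : Measure ℝ} {η : ENNReal}
    (hν : ∀ x (g : ℝ → ENNReal), Measurable g → (∀ s, g s ≤ 1) →
      ∫⁻ y, g y ∂K x ≤ ∫⁻ y, g y ∂ν + η)
    {G : Set Ω} (hG : MeasurableSet[m] G) {S : Ω → ℝ} (hS : Measurable[m] S) {g : ℝ → ENNReal}
    (hg : Measurable g) (hg1 : ∀ s, g s ≤ 1) :
    ∫⁻ ω in G, g (S ω + Z ω) ∂Pr ≤ ∫⁻ ω in G, min 1 (∫⁻ y, g (S ω + y) ∂ν + η) ∂Pr := by
  have hS' : Measurable S := hS.mono hm le_rfl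
  have hT' : Measurable T := hT.mono hm le_rfl
  have hsum : ∀ φ : Ω → ENNReal, ∫⁻ ω in G, φ ω ∂Pr =
      ∑ x, ∫⁻ ω in G ∩ {ω | T ω = x}, φ ω ∂Pr := by
    intro φ
    have hU : G = ⋃ x ∈ (Finset.univ : Finset 𝒳), G ∩ {ω | T ω = x} := by
      ext ω; simp
    conv_lhs => rw [hU]
    rw [lintegral_biUnion_finset]
    · intro x _ y _ hxy
      refine Set.disjoint_left.2 fun ω h1 h2 => hxy ?_
      exact h1.2.symm.trans h2.2
    · exact fun x _ => (hm _ hG).inter (hT' (measurableSet_singleton x))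
  rw [hsum, hsum]
  refine Finset.sum_le_sum fun x _ => ?_
  set A := G ∩ {ω | T ω = x} with hA
  have hlaw : (Pr.restrict A).map (fun ω => (S ω, Z ω)) = ((Pr.restrict A).map S).prod (K x) := by
    refine (Measure.prod_eq fun B₁ B₂ h₁ h₂ => ?_).symm
    rw [Measure.map_apply (hS'.prodMk hZ) (h₁.prod h₂), Measure.map_apply hS' h₁,
      Measure.restrict_apply (hS'.prodMk hZ (h₁.prod h₂)), Measure.restrict_apply (hS' h₁)]
    have := hK (G ∩ S ⁻¹' B₁) (hG.inter (hS h₁)) x B₂ h₂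
    convert this using 2
    · ext ω
      simp [hA]; tauto
    · congr 1
      ext ω
      simp [hA]; tauto
  calc ∫⁻ ω in A, g (S ω + Z ω) ∂Pr
      = ∫⁻ q, g (q.1 + q.2) ∂((Pr.restrict A).map (fun ω => (S ω, Z ω))) :=
        (lintegral_map (f := fun q : ℝ × ℝ => g (q.1 + q.2)) (by fun_prop)
          (hS'.prodMk hZ)).symm
    _ = ∫⁻ s, ∫⁻ y, g (s + y) ∂K x ∂((Pr.restrict A).map S) := by
        rw [hlaw, lintegral_prod _ (by fun_prop)]
    _ = ∫⁻ ω in A, ∫⁻ y, g (S ω + y) ∂K x ∂Pr :=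
        lintegral_map (f := fun s => ∫⁻ y, g (s + y) ∂K x)
          (Measurable.lintegral_prod_right' (f := fun q : ℝ × ℝ => g (q.1 + q.2)) (by fun_prop)) hS'
    _ ≤ _ := by
        refine lintegral_mono fun ω => le_min ?_ (hν x _ (by fun_prop) fun s => hg1 _)
        calc _ ≤ ∫⁻ _, 1 ∂K x := lintegral_mono fun y => hg1 _
          _ = 1 := by simp

section Mixtures

variable {𝒳 : Type*} [Fintype 𝒳]

/-- The mixture `∑ x, q x • κ x`. -/
noncomputable def mixture (q : 𝒳 → ℝ) (κ : 𝒳 → Measure ℝ) : Measure ℝ :=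
  ∑ x, ENNReal.ofReal (q x) • κ x

lemma mixture_apply (q : 𝒳 → ℝ) (κ : 𝒳 → Measure ℝ) (B : Set ℝ) :
    mixture q κ B = ∑ x, ENNReal.ofReal (q x) * κ x B := by
  simp [mixture]

lemma lintegral_mixture (q : 𝒳 → ℝ) (κ : 𝒳 → Measure ℝ) (g : ℝ → ENNReal) :
    ∫⁻ y, g y ∂mixture q κ = ∑ x, ENNReal.ofReal (q x) * ∫⁻ y, g y ∂κ x := by
  simp [mixture, lintegral_finsetSum_measure, lintegral_smul_measure]

lemma isProbabilityMeasure_mixture {q : 𝒳 → ℝ} (hq : ∀ x, 0 ≤ q x) (hq1 : ∑ x, q x = 1)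
    (κ : 𝒳 → Measure ℝ) [∀ x, IsProbabilityMeasure (κ x)] :
    IsProbabilityMeasure (mixture q κ) := by
  refine ⟨?_⟩
  simp [mixture_apply, ← ENNReal.ofReal_sum_of_nonneg fun x _ => hq x, hq1]

lemma integrable_mixture (q : 𝒳 → ℝ) {κ : 𝒳 → Measure ℝ} {φ : ℝ → ℝ}
    (h : ∀ x, Integrable φ (κ x)) : Integrable φ (mixture q κ) := by
  rw [mixture, integrable_finsetSum_measure]
  exact fun x _ => (h x).smul_measure ENNReal.ofReal_ne_top

lemma integral_mixture {q : 𝒳 → ℝ} (hq : ∀ x, 0 ≤ q x) {κ : 𝒳 → Measure ℝ} {φ : ℝ → ℝ}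
    (h : ∀ x, Integrable φ (κ x)) :
    ∫ y, φ y ∂mixture q κ = ∑ x, q x * ∫ y, φ y ∂κ x := by
  rw [mixture, integral_finsetSum_measure fun x _ => (h x).smul_measure ENNReal.ofReal_ne_top]
  simp [integral_smul_measure, ENNReal.toReal_ofReal, hq]

/-- The Huber contamination of `D` by `Q` at level `ε`. -/
noncomputable def contaminate (ε : ℝ) (D Q : Measure ℝ) : Measure ℝ :=
  ENNReal.ofReal (1 - ε) • D + ENNReal.ofReal ε • Q

lemma isProbabilityMeasure_contaminate {ε : ℝ} (h0 : 0 ≤ ε) (h1 : ε ≤ 1) (D Q : Measure ℝ)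
    [IsProbabilityMeasure D] [IsProbabilityMeasure Q] :
    IsProbabilityMeasure (contaminate ε D Q) := by
  refine ⟨?_⟩
  simp [contaminate, ← ENNReal.ofReal_add (by linarith : 0 ≤ 1 - ε) h0]

lemma lintegral_mixture_contaminate_le {q π : 𝒳 → ℝ} (hq : ∀ x, 0 ≤ q x) (hq1 : ∑ x, q x = 1)
    {η ε : ℝ} (hη : ∑ x, |q x - π x| ≤ η) (h0 : 0 ≤ ε)
    (D Q : 𝒳 → Measure ℝ) [∀ x, IsProbabilityMeasure (D x)] [∀ x, IsProbabilityMeasure (Q x)]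
    {g : ℝ → ENNReal} (hg1 : ∀ s, g s ≤ 1) :
    ∫⁻ y, g y ∂mixture q (fun x => contaminate ε (D x) (Q x)) ≤
      ∫⁻ y, g y ∂mixture π D + ENNReal.ofReal (η + ε) := by
  have hle1 : ∀ (κ : Measure ℝ) [IsProbabilityMeasure κ], ∫⁻ y, g y ∂κ ≤ 1 := fun κ _ =>
    (lintegral_mono hg1).trans (by simp)
  have hη0 : 0 ≤ η := (Finset.sum_nonneg fun x _ => abs_nonneg _).trans hη
  have hterm : ∀ x, ENNReal.ofReal (q x) * ∫⁻ y, g y ∂contaminate ε (D x) (Q x) ≤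
      ENNReal.ofReal (π x) * ∫⁻ y, g y ∂D x + ENNReal.ofReal |q x - π x| +
        ENNReal.ofReal (q x) * ENNReal.ofReal ε := by
    intro x
    have h1 : ∫⁻ y, g y ∂contaminate ε (D x) (Q x) ≤ ∫⁻ y, g y ∂D x + ENNReal.ofReal ε := by
      rw [contaminate, lintegral_add_measure, lintegral_smul_measure, lintegral_smul_measure]
      refine add_le_add ?_ ?_
      · exact mul_le_of_le_one_left' (ENNReal.ofReal_le_one.2 (by linarith))
      · exact mul_le_of_le_one_right' (hle1 (Q x))
    have h2 : ENNReal.ofReal (q x) ≤ ENNReal.ofReal (π x) + ENNReal.ofReal |q x - π x| := by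
      refine le_trans (ENNReal.ofReal_le_ofReal ?_) ENNReal.ofReal_add_le
      linarith [le_abs_self (q x - π x)]
    calc _ ≤ ENNReal.ofReal (q x) * (∫⁻ y, g y ∂D x + ENNReal.ofReal ε) := by gcongr
      _ = ENNReal.ofReal (q x) * ∫⁻ y, g y ∂D x + ENNReal.ofReal (q x) * ENNReal.ofReal ε :=
        mul_add _ _ _
      _ ≤ _ := by
        gcongr
        calc _ ≤ (ENNReal.ofReal (π x) + ENNReal.ofReal |q x - π x|) * ∫⁻ y, g y ∂D x := by
              gcongr
          _ ≤ _ := by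
              rw [add_mul]
              gcongr
              exact mul_le_of_le_one_right' (hle1 (D x))
  rw [lintegral_mixture, lintegral_mixture, ENNReal.ofReal_add hη0 h0]
  refine (Finset.sum_le_sum fun x _ => hterm x).trans ?_
  rw [Finset.sum_add_distrib, Finset.sum_add_distrib, ← Finset.sum_mul,
    ← ENNReal.ofReal_sum_of_nonneg (fun x _ => hq x), hq1,
    ← ENNReal.ofReal_sum_of_nonneg (fun x _ => abs_nonneg _), ENNReal.ofReal_one, one_mul,
    add_assoc]
  gcongr

end Mixtures

section Rumem

lemma IsMedianOf.abs_sub_le {L : ℕ} {vals : ℕ → ℝ} {med c t : ℝ} (h : IsMedianOf L vals med)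
    (hbad : 2 * ((Finset.range L).filter fun i => t < |vals i - c|).card < L) :
    |med - c| ≤ t := by
  by_contra! hlt
  rcases lt_abs.1 hlt with hgt | hgt
  · have : ((Finset.range L).filter fun i => med ≤ vals i).card ≤
        ((Finset.range L).filter fun i => t < |vals i - c|).card := by
      refine Finset.card_le_card (Finset.monotone_filter_right _ fun i _ hi => ?_)
      exact lt_abs.2 (Or.inl (by linarith))
    have := h.2
    omega
  · have : ((Finset.range L).filter fun i => vals i ≤ med).card ≤
        ((Finset.range L).filter fun i => t < |vals i - c|).card := by
      refine Finset.card_le_card (Finset.monotone_filter_right _ fun i _ hi => ?_)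
      exact lt_abs.2 (Or.inr (by linarith))
    have := h.1
    omega

lemma log_div_bounds {N : ℕ} {δ : ℝ} (hδ0 : 0 < δ) (hδ1 : δ < 1) (hN : 2 ≤ N) :
    0.69 ≤ Real.log (N / δ) ∧ 0 ≤ Real.log (24 / δ) ∧
      Real.log (24 / δ) ≤ 5 * Real.log (N / δ) := by
  have hN2 : (2 : ℝ) ≤ N := by exact_mod_cast hN
  have h2 : 2 / δ ≤ N / δ := by gcongr
  have h2' : 2 ≤ 2 / δ := by rw [le_div_iff₀ hδ0]; linarith
  refine ⟨?_, Real.log_nonneg ?_, ?_⟩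
  · have := Real.log_le_log two_pos (h2'.trans h2)
    linarith [Real.log_two_gt_d9]
  · rw [le_div_iff₀ hδ0]; linarith
  · have h5 : 24 / δ ≤ (N / δ) ^ 5 := by
      calc 24 / δ ≤ 2 ^ 4 * (2 / δ) := by
            rw [← mul_div_assoc]; gcongr; norm_num
        _ ≤ (2 / δ) ^ 4 * (2 / δ) := by gcongr
        _ = (2 / δ) ^ 5 := by ring
        _ ≤ _ := by gcongr
    have := Real.log_le_log (by positivity) h5
    rwa [Real.log_pow] at this

/-- Numerical consequences of the choice of the parameters of RUMEM. -/
lemma rumem_parameter_bounds {N τ n L : ℕ} {ε δ ε' : ℝ} (hε : 0 ≤ ε) (hδ0 : 0 < δ) (hδ1 : δ < 1)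
    (hτ : 1 ≤ τ) (hn : n = (N - 1) / τ + 1) (hε' : ε' = ε + 32 / (3 * n) * Real.log (24 / δ))
    (hL : L = ⌈12 * ε' * n + (256 / 7) * Real.log (N / δ)⌉₊) (hN : 2 ≤ N)
    (hNL : 4 * L * τ ≤ N) :
    1 ≤ n / L ∧ ((n / L : ℕ) : ℝ) * (1 / (3 * N) + ε) + 1 / 72 ≤ 1 / 9 ∧ (2 / 3 : ℝ) ^ L ≤ δ ∧
      1 / ((n / L : ℕ) : ℝ) ≤ 1400 * (ε + τ / N * Real.log (N / δ)) := by
  obtain ⟨hl, h24, h5⟩ := log_div_bounds hδ0 hδ1 hN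
  set l := Real.log (N / δ) with hldef
  have hn1 : 1 ≤ n := by rw [hn]; exact Nat.le_add_left 1 _
  have hnR : (1 : ℝ) ≤ n := by exact_mod_cast hn1
  have hNn : N ≤ τ * n := by
    have := Nat.lt_mul_div_succ (N - 1) (by omega : 0 < τ)
    rw [hn]; omega
  have hnN : n ≤ N := by
    have := Nat.div_le_self (N - 1) τ
    omega
  have h4L : 4 * L ≤ n := by
    have : τ * (4 * L) ≤ τ * n := by linarith
    exact Nat.le_of_mul_le_mul_left this (by omega)
  have hexp : 12 * ε' * n + (256 / 7) * l =
      12 * ε * n + 128 * Real.log (24 / δ) + (256 / 7) * l := by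
    rw [hε']; field_simp; ring
  rw [hexp] at hL
  have hεn : 0 ≤ 12 * ε * n := by positivity
  have hLlo : 12 * ε * n + 128 * Real.log (24 / δ) + (256 / 7) * l ≤ L := hL ▸ Nat.le_ceil _
  have hLhi : (L : ℝ) ≤ 12 * ε * n + 679 * l := by
    have : (L : ℝ) < 12 * ε * n + 128 * Real.log (24 / δ) + (256 / 7) * l + 1 :=
      hL ▸ Nat.ceil_lt_add_one (by positivity)
    linarith
  have hL25 : (25 : ℝ) ≤ L := by linarith
  have hL0 : 0 < L := by
    have : (0 : ℝ) < L := by linarith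
    exact_mod_cast this
  set M := n / L with hM
  have hM1 : 1 ≤ M := (Nat.one_le_div_iff hL0).2 (by omega)
  have hML : (M : ℝ) * L ≤ n := by exact_mod_cast Nat.div_mul_le_self n L
  have hM2 : (n : ℝ) ≤ 2 * (M * L) := by
    have h1 := Nat.lt_mul_div_succ n hL0
    have h2 : n ≤ 2 * (M * L) := by nlinarith
    exact_mod_cast h2
  have hMpos : (1 : ℝ) ≤ M := by exact_mod_cast hM1
  have hNpos : (0 : ℝ) < N := by positivity
  have hnNR : (n : ℝ) ≤ N := by exact_mod_cast hnN
  have hNnR : (N : ℝ) ≤ τ * n := by exact_mod_cast hNn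
  refine ⟨hM1, ?_, ?_, ?_⟩
  · have h1 : (M : ℝ) * (1 / (3 * N)) ≤ 1 / 75 := by
      rw [mul_one_div, div_le_div_iff₀ (by positivity) (by norm_num)]
      nlinarith
    have h2 : (M : ℝ) * ε ≤ 1 / 12 := by
      have h3 : 12 * ε * (M * L) ≤ L := by
        have : 12 * ε * (M * L) ≤ 12 * ε * n := by gcongr
        linarith
      have hLR : (0 : ℝ) < L := by linarith
      have : (12 * (M * ε)) * L ≤ 1 * L := by linarith
      linarith [le_of_mul_le_mul_right this hLR]
    rw [mul_add]
    linarith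
  · have hlog : Real.log (2 / 3) ≤ -(1 / 3) := by
      have := Real.log_le_sub_one_of_pos (by norm_num : (0 : ℝ) < 2 / 3)
      linarith
    have hNδ : Real.log (N / δ) = Real.log N - Real.log δ := Real.log_div (by positivity) hδ0.ne'
    have hlogN : 0 ≤ Real.log N := Real.log_natCast_nonneg N
    rw [← Real.log_le_log_iff (by positivity) hδ0, Real.log_pow]
    nlinarith
  · have hLn : (L : ℝ) / n ≤ 12 * ε + 679 * (τ / N * l) := by
      have h1 : 1 / (n : ℝ) ≤ τ / N := by
        rw [div_le_div_iff₀ (by positivity) hNpos]; linarith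
      calc (L : ℝ) / n ≤ (12 * ε * n + 679 * l) / n := by gcongr
        _ = 12 * ε + 679 * (1 / n * l) := by field_simp
        _ ≤ _ := by gcongr
    have hinv : 1 / (M : ℝ) ≤ 2 * (L / n) := by
      rw [← mul_div_assoc, div_le_div_iff₀ (by positivity) (by positivity)]
      linarith
    have : 0 ≤ (τ : ℝ) / N * l := by positivity
    linarith

/-- Subsampling at the rate used by RUMEM brings the chain close to stationarity. -/
lemma sum_abs_pow_sub_le_of_subsampling {𝒳 : Type*} [Fintype 𝒳] [DecidableEq 𝒳] [Nonempty 𝒳]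
    {P : Matrix 𝒳 𝒳 ℝ} (h0 : ∀ x y, 0 ≤ P x y)
    (h1 : ∀ x, ∑ y, P x y = 1) (hk : ∃ k : ℕ, ∀ x y, 0 < (P ^ k) x y)
    {π : 𝒳 → ℝ} (hπ : ∀ x, 0 < π x) (hπ1 : ∑ x, π x = 1) (hst : Matrix.vecMul π P = π)
    {N τ : ℕ} {δ : ℝ} (hδ0 : 0 < δ) (hδ1 : δ < 1) (hN : 2 ≤ N)
    (hτ : τ = ⌈Real.logb 2 (6 * N / δ) * (tmixMat P π : ℝ)⌉₊) :
    1 ≤ τ ∧ ∀ x, ∑ y, |(P ^ τ) x y - π y| ≤ 1 / (3 * N) := by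
  obtain ⟨ht, hmix⟩ := tmixMat_pos_and_sum_abs_le h0 h1 hk hπ hπ1 hst
  set t := tmixMat P π
  have hN2 : (2 : ℝ) ≤ N := by exact_mod_cast hN
  have htR : (1 : ℝ) ≤ t := by exact_mod_cast ht
  have h12 : 2 ≤ 6 * N / δ := by rw [le_div_iff₀ hδ0]; nlinarith
  have hb : 1 ≤ Real.logb 2 (6 * N / δ) := by
    rw [Real.le_logb_iff_rpow_le one_lt_two (by linarith)]
    simpa using h12
  set b := Real.logb 2 (6 * N / δ) with hbdef
  have hbτ : b * t ≤ τ := hτ ▸ Nat.le_ceil _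
  refine ⟨?_, fun x => ?_⟩
  · have : (1 : ℝ) ≤ τ := by nlinarith
    exact_mod_cast this
  have hfl : (⌊b⌋₊ : ℝ) ≤ b := Nat.floor_le (by linarith)
  refine (hmix ⌊b⌋₊ τ (Nat.le_floor (by simpa using hb)) ?_ x).trans ?_
  · have : (⌊b⌋₊ : ℝ) * t ≤ τ := by nlinarith
    exact_mod_cast this
  · have h2 : 6 * N / δ < 2 ^ (⌊b⌋₊ + 1) := by
      have := (Real.logb_lt_iff_lt_rpow one_lt_two (by linarith)).1 (Nat.lt_floor_add_one b)
      exact_mod_cast this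
    have h3 : (6 : ℝ) * N ≤ 6 * N / δ := by
      rw [le_div_iff₀ hδ0]; nlinarith
    rw [pow_succ] at h2
    rw [_root_.one_div_pow]
    exact one_div_le_one_div_of_le (by positivity) (by linarith)

lemma integral_sub_sq_le {κ : Measure ℝ} [IsProbabilityMeasure κ] (h1 : Integrable (fun y => y) κ)
    (h2 : Integrable (fun y => y ^ 2) κ) (c : ℝ) :
    ∫ y, (y - c) ^ 2 ∂κ = ∫ y, (y - ∫ z, z ∂κ) ^ 2 ∂κ + ((∫ z, z ∂κ) - c) ^ 2 := by
  have key : ∀ c : ℝ, ∫ y, (y - c) ^ 2 ∂κ = ∫ y, y ^ 2 ∂κ - 2 * c * ∫ z, z ∂κ + c ^ 2 := by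
    intro c
    have hi : Integrable (fun y => y ^ 2 - 2 * c * y) κ := h2.sub (h1.const_mul _)
    have : (fun y : ℝ => (y - c) ^ 2) = fun y => (y ^ 2 - 2 * c * y) + c ^ 2 := by
      ext y; ring
    rw [this, integral_add hi (integrable_const _), integral_sub h2 (h1.const_mul _),
      integral_const_mul]
    simp
  rw [key c, key (∫ z, z ∂κ)]
  ring

/-- The variance of a mixture is at most the bound on the variances plus the spread of the
means. -/
lemma integral_mixture_sub_sq_le {𝒳 : Type*} [Fintype 𝒳] {π : 𝒳 → ℝ} (hπ : ∀ x, 0 ≤ π x)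
    (hπ1 : ∑ x, π x = 1) {F : 𝒳 → ℝ} {ψ ρ : ℝ} (hF : ∀ x, |F x| ≤ ψ) {κ : 𝒳 → Measure ℝ}
    [∀ x, IsProbabilityMeasure (κ x)] (h1 : ∀ x, Integrable (fun y => y) (κ x))
    (h2 : ∀ x, Integrable (fun y => y ^ 2) (κ x)) (hmean : ∀ x, ∫ y, y ∂κ x = F x)
    (hvar : ∀ x, ∫ y, (y - F x) ^ 2 ∂κ x ≤ ρ ^ 2) :
    ∫ y, (y - ∑ x, π x * F x) ^ 2 ∂mixture π κ ≤ ρ ^ 2 + ψ ^ 2 := by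
  set c := ∑ x, π x * F x with hc
  have hint : ∀ x, Integrable (fun y => (y - c) ^ 2) (κ x) := by
    intro x
    have : (fun y : ℝ => (y - c) ^ 2) = fun y => (y ^ 2 - 2 * c * y) + c ^ 2 := by
      ext y; ring
    rw [this]
    exact ((h2 x).sub ((h1 x).const_mul _)).add (integrable_const _)
  rw [integral_mixture hπ hint]
  have hterm : ∀ x, π x * ∫ y, (y - c) ^ 2 ∂κ x ≤
      π x * (ρ ^ 2 + ψ ^ 2 + c ^ 2) - 2 * c * (π x * F x) := by
    intro x
    rw [integral_sub_sq_le (h1 x) (h2 x), hmean]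
    have : F x ^ 2 ≤ ψ ^ 2 := by
      rw [← sq_abs (F x)]; exact pow_le_pow_left₀ (abs_nonneg _) (hF x) 2
    have h3 := hvar x
    calc _ ≤ π x * (ρ ^ 2 + ψ ^ 2 + c ^ 2 - 2 * c * F x) :=
          mul_le_mul_of_nonneg_left (by nlinarith) (hπ x)
      _ = _ := by ring
  refine (Finset.sum_le_sum fun x _ => hterm x).trans ?_
  rw [Finset.sum_sub_distrib, ← Finset.sum_mul, ← Finset.mul_sum, hπ1, ← hc]
  nlinarith [sq_nonneg c]

/-- The number of original samples seen once `m` subsampled observations have been made. -/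
def samplesSeen (τ : ℕ) : ℕ → ℕ
  | 0 => 0
  | m + 1 => m * τ + 1

lemma samplesSeen_mono (τ : ℕ) : Monotone (samplesSeen τ) := by
  refine monotone_nat_of_le_succ fun m => ?_
  cases m with
  | zero => simp [samplesSeen]
  | succ m => simp only [samplesSeen]; nlinarith

/-- Given the past, a subsampled observation of the contaminated chain is within `η + ε` of an
uncontaminated stationary observation. -/
lemma HasCylinderLaw.setLIntegral_subsample_le {Ω 𝒳 : Type*} [MeasurableSpace Ω] {Pr : Measure Ω}
    [IsProbabilityMeasure Pr] [Fintype 𝒳] [DecidableEq 𝒳] [Nonempty 𝒳] [MeasurableSpace 𝒳]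
    [MeasurableSingletonClass 𝒳] {P : Matrix 𝒳 𝒳 ℝ} (h0 : ∀ x y, 0 ≤ P x y)
    (h1 : ∀ x, ∑ y, P x y = 1) {π : 𝒳 → ℝ} (hπ : ∀ x, 0 ≤ π x) (hπ1 : ∑ x, π x = 1)
    {ε : ℝ} (hε0 : 0 ≤ ε) (hε1 : ε ≤ 1) {D : 𝒳 → Measure ℝ} [∀ x, IsProbabilityMeasure (D x)]
    {Q : ℕ → 𝒳 → Measure ℝ} [∀ k x, IsProbabilityMeasure (Q k x)]
    {X : ℕ → Ω → 𝒳} {Y : ℕ → Ω → ℝ} (hX : ∀ k, Measurable (X k)) (hY : ∀ k, Measurable (Y k))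
    (h : HasCylinderLaw Pr (fun x => ENNReal.ofReal (π x)) (fun x y => ENNReal.ofReal (P x y))
      (fun k x => contaminate ε (D x) (Q k x)) X Y)
    {τ : ℕ} (hτ : 1 ≤ τ) {η : ℝ} (hη : 0 ≤ η) (hmix : ∀ x, ∑ y, |(P ^ τ) x y - π y| ≤ η)
    (m : ℕ) {G : Set Ω} (hG : MeasurableSet[pathSigma X Y (samplesSeen τ m)] G) {S : Ω → ℝ}
    (hS : Measurable[pathSigma X Y (samplesSeen τ m)] S) {g : ℝ → ENNReal} (hg : Measurable g)
    (hg1 : ∀ s, g s ≤ 1) :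
    ∫⁻ ω in G, g (S ω + Y (m * τ) ω) ∂Pr ≤
      ∫⁻ ω in G, min 1 (∫⁻ y, g (S ω + y) ∂mixture π D + ENNReal.ofReal (η + ε)) ∂Pr := by
  have hcont : ∀ k x, IsProbabilityMeasure (contaminate ε (D x) (Q k x)) := fun k x =>
    isProbabilityMeasure_contaminate hε0 hε1 _ _
  cases m with
  | zero =>
    have hK := isProbabilityMeasure_mixture hπ hπ1 fun x => contaminate ε (D x) (Q 0 x)
    obtain ⟨x₀⟩ := ‹Nonempty 𝒳›
    rw [zero_mul]
    refine setLIntegral_add_le_of_label (pathSigma_le hX hY _) (T := fun _ => x₀)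
      (K := fun _ => mixture π fun x => contaminate ε (D x) (Q 0 x)) measurable_const (hY 0)
      (fun G hG x B hB => ?_) (fun x g _ hg1 => ?_) hG hS hg hg1
    · have hYB : Pr {ω | Y 0 ω ∈ B} = mixture π (fun x => contaminate ε (D x) (Q 0 x)) B := by
        rw [h.measure_zero hX hB, mixture_apply]
      obtain ⟨E, -, rfl⟩ := hG
      by_cases hx : x₀ = x
      · by_cases hE : E.Nonempty
        · obtain ⟨e, he⟩ := hE
          have huniv : pathMap X Y (samplesSeen τ 0) ⁻¹' E = Set.univ := by
            have : Subsingleton ((Fin (samplesSeen τ 0) → 𝒳) × (Fin (samplesSeen τ 0) → ℝ)) := by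
              simp only [samplesSeen]; infer_instance
            ext ω
            simp only [Set.mem_preimage, Set.mem_univ, iff_true]
            rwa [Subsingleton.elim (pathMap X Y (samplesSeen τ 0) ω) e]
          simp [huniv, hx, hYB]
        · simp [Set.not_nonempty_iff_eq_empty.1 hE]
      · simp [hx]
    · exact lintegral_mixture_contaminate_le hπ hπ1 (by simpa using hη) hε0 D (Q 0) hg1
  | succ m =>
    obtain ⟨s, rfl⟩ : ∃ s, τ = s + 1 := ⟨τ - 1, by omega⟩
    have hpow := fun k => pow_nonneg_row_sum h0 h1 k
    set k := m * (s + 1) with hkdef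
    have hidx : (m + 1) * (s + 1) = k + s + 1 := by rw [hkdef]; ring
    have hK := fun x => isProbabilityMeasure_mixture ((hpow (s + 1)).1 x) ((hpow (s + 1)).2 x)
      fun y => contaminate ε (D y) (Q (k + s + 1) y)
    rw [hidx]
    refine setLIntegral_add_le_of_label (pathSigma_le hX hY _) (T := X k)
      (K := fun x => mixture ((P ^ (s + 1)) x) fun y => contaminate ε (D y) (Q (k + s + 1) y))
      (measurable_pathSigma_state X Y (Nat.lt_succ_self k)) (hY _)
      (fun G hG x B hB => ?_) (fun x g _ hg1 => ?_) hG hS hg hg1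
    · rw [measure_eq_sum_inter_preimage Pr fun y => hX (k + s + 1) (measurableSet_singleton y),
        mixture_apply, Finset.mul_sum]
      refine Finset.sum_congr rfl fun y _ => ?_
      rw [← h.measure_inter_add (fun s => (hpow s).1) hX hY hG x s y hB]
      congr 1
      ext ω
      simp only [Set.mem_inter_iff, Set.mem_ofPred_eq, Set.mem_preimage, Set.mem_singleton_iff]
      tauto
    · exact lintegral_mixture_contaminate_le ((hpow (s + 1)).1 x) ((hpow (s + 1)).2 x) (hmix x)
        hε0 D (Q (k + s + 1)) hg1

lemma subsampledBucketMean_sub {τ M : ℕ} (hM : 1 ≤ M) (y : ℕ → ℝ) (i : ℕ) (c : ℝ) :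
    subsampledBucketMean τ M y i - c = (∑ j ∈ Finset.range M, (y ((i * M + j) * τ) - c)) / M := by
  have : (M : ℝ) ≠ 0 := by positivity
  rw [subsampledBucketMean, Finset.sum_sub_distrib]
  simp
  field_simp

end Rumem

/-- **Performance of RUMEM** (robust univariate mean estimation from
Huber-contaminated Markovian data). There is a universal constant `C ≥ 1` such
that: for any stationary ergodic finite-state chain with stationary law `π`,
any observation model with conditional means `F` (`|F| ≤ ψ`) and conditional
variances `≤ ρ²`, any Huber contamination of level `ε` by arbitrary adversarial
distributions, and any `δ ∈ (0,1)`, if RUMEM is run with parameters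
`τ = ⌈log₂(6N/δ) τ_mix⌉`, `n = ⌊(N−1)/τ⌋ + 1`, `ε′ = ε + (32/(3n)) log(24/δ)`,
`L = ⌈12ε′n + (256/7) log(N/δ)⌉` and `N ≥ max{2, 4Lτ}`, then with probability at
least `1 − δ` its output `μ̂` satisfies
`|μ̂ − f̄| ≤ C max{ψ, ρ} (√ε + √((τ/N) log(N/δ)))`. -/
theorem rumem_performance :
    ∃ C : ℝ, 1 ≤ C ∧
    ∀ (Ω : Type) [MeasurableSpace Ω] (Pr : Measure Ω) [IsProbabilityMeasure Pr]
      (𝒳 : Type) [Fintype 𝒳] [DecidableEq 𝒳] [MeasurableSpace 𝒳]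
      [MeasurableSingletonClass 𝒳]
      -- ergodic transition matrix and stationary distribution
      (P : Matrix 𝒳 𝒳 ℝ), (∀ x y, 0 ≤ P x y) → (∀ x, ∑ y, P x y = 1) →
      (∃ k : ℕ, ∀ x y, 0 < (P ^ k) x y) →
    ∀ (π : 𝒳 → ℝ), (∀ x, 0 < π x) → (∑ x, π x = 1) → (Matrix.vecMul π P = π) →
    -- bounded function F and conditional observation distributions 𝒟(·|x)
    ∀ (F : 𝒳 → ℝ) (ψ ρ : ℝ), 0 < ψ → 0 < ρ → (∀ x, |F x| ≤ ψ) →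
    ∀ (𝒟 : 𝒳 → Measure ℝ), (∀ x, IsProbabilityMeasure (𝒟 x)) →
      (∀ x, Integrable (fun y => y) (𝒟 x)) →
      (∀ x, Integrable (fun y => y ^ 2) (𝒟 x)) →
      (∀ x, (∫ y, y ∂𝒟 x) = F x) →
      (∀ x, (∫ y, (y - F x) ^ 2 ∂𝒟 x) ≤ ρ ^ 2) →
    -- corruption level and adversarial (state- and time-dependent) distributions
    ∀ (ε : ℝ), 0 ≤ ε → ε < 1 / 2 →
    ∀ (Q : ℕ → 𝒳 → Measure ℝ), (∀ k x, IsProbabilityMeasure (Q k x)) →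
    -- the stationary chain and the contaminated observations, with the joint law
    -- specified on all finite cylinders
    ∀ (X : ℕ → Ω → 𝒳) (ftil : ℕ → Ω → ℝ),
      (∀ k, Measurable (X k)) → (∀ k, Measurable (ftil k)) →
      (∀ (n : ℕ) (f : Fin (n + 1) → 𝒳) (B : Fin (n + 1) → Set ℝ),
        (∀ k, MeasurableSet (B k)) →
        Pr {ω | ∀ k : Fin (n + 1), X k ω = f k ∧ ftil k ω ∈ B k} =
          ENNReal.ofReal (π (f 0)) *
            (∏ k : Fin n, ENNReal.ofReal (P (f k.castSucc) (f k.succ))) *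
            ∏ k : Fin (n + 1),
              (ENNReal.ofReal (1 - ε) * 𝒟 (f k) (B k) +
                ENNReal.ofReal ε * Q k (f k) (B k))) →
    -- confidence level, sample size, and the RUMEM parameters
    ∀ (δ : ℝ), 0 < δ → δ < 1 →
    ∀ (N τ n L : ℕ) (ε' : ℝ),
      τ = ⌈Real.logb 2 (6 * N / δ) * (tmixMat P π : ℝ)⌉₊ →
      n = (N - 1) / τ + 1 →
      ε' = ε + 32 / (3 * n) * Real.log (24 / δ) →
      L = ⌈12 * ε' * n + (256 / 7) * Real.log (N / δ)⌉₊ →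
      2 ≤ N → 4 * L * τ ≤ N →
    -- the output of RUMEM: a median of the bucket means of the subsampled data
    ∀ (muhat : Ω → ℝ),
      (∀ ω, IsMedianOf L (subsampledBucketMean τ (n / L) fun k => ftil k ω) (muhat ω)) →
      ENNReal.ofReal (1 - δ) ≤
        Pr {ω | |muhat ω - ∑ x, π x * F x| ≤
          C * max ψ ρ *
            (Real.sqrt ε + Real.sqrt ((τ / N : ℝ) * Real.log (N / δ)))} := by
  refine ⟨450, by norm_num, ?_⟩
  intro Ω _ Pr _ 𝒳 _ _ _ _ P h0 h1 hk π hπ hπ1 hst F ψ ρ hψ hρ hF 𝒟 hD hD1 hD2 hmean hvar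
    ε hε0 hε2 Q hQ X ftil hX hf hlaw δ hδ0 hδ1 N τ n L ε' hτ hn hε' hL hN hNL muhat hmed
  have : Nonempty 𝒳 := by
    by_contra hne
    rw [not_nonempty_iff] at hne
    simp at hπ1
  obtain ⟨hτ1, hmix⟩ :=
    sum_abs_pow_sub_le_of_subsampling h0 h1 hk hπ hπ1 hst hδ0 hδ1 hN hτ
  obtain ⟨hM1, hp, hδL, hMinv⟩ :=
    rumem_parameter_bounds hε0 hδ0 hδ1 hτ1 hn hε' hL hN hNL
  set M := n / L
  set A := (τ : ℝ) / N * Real.log (N / δ)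
  set c := ∑ x, π x * F x with hc
  have hMpos : (0 : ℝ) < M := by exact_mod_cast hM1
  have hcyl : HasCylinderLaw Pr (fun x => ENNReal.ofReal (π x))
      (fun x y => ENNReal.ofReal (P x y)) (fun k x => contaminate ε (𝒟 x) (Q k x)) X ftil := by
    intro n f B hB
    simpa [contaminate] using hlaw n f B hB
  have hπ0 : ∀ x, 0 ≤ π x := fun x => (hπ x).le
  set ν₀ := mixture π 𝒟
  have hν₀ : IsProbabilityMeasure ν₀ := isProbabilityMeasure_mixture hπ0 hπ1 𝒟
  have hν₁ : Integrable (fun y => y) ν₀ := integrable_mixture π hD1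
  have hν₂ : Integrable (fun y => y ^ 2) ν₀ := integrable_mixture π hD2
  have hνmean : ∫ y, y ∂ν₀ = c := by
    rw [integral_mixture hπ0 hD1]
    simp [hmean, hc]
  have hνsub : Integrable (fun y => y - c) ν₀ := hν₁.sub (integrable_const _)
  have hνsub2 : Integrable (fun y => (y - c) ^ 2) ν₀ := by
    have : (fun y : ℝ => (y - c) ^ 2) = fun y => (y ^ 2 - 2 * c * y) + c ^ 2 := by
      ext y; ring
    rw [this]
    exact (hν₂.sub (hν₁.const_mul _)).add (integrable_const _)
  have hmeas : Measurable fun y : ℝ => y - c := measurable_id.sub_const c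
  set ν := ν₀.map fun y => y - c
  have hν : IsProbabilityMeasure ν := Measure.isProbabilityMeasure_map hmeas.aemeasurable
  set v := ρ ^ 2 + ψ ^ 2 with hvdef
  have hvpos : 0 < v := by positivity
  set t := Real.sqrt (72 * v / M)
  have htpos : 0 < t := Real.sqrt_pos.2 (by positivity)
  have ht2 : t ^ 2 = 72 * v / M := Real.sq_sqrt (by positivity)
  set 𝒢 : ℕ → MeasurableSpace Ω := fun m => pathSigma X ftil (samplesSeen τ m)
  have h𝒢 : Monotone 𝒢 := (pathSigma_mono X ftil).comp (samplesSeen_mono τ)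
  have h𝒢le : ∀ m, 𝒢 m ≤ ‹MeasurableSpace Ω› := fun m => pathSigma_le hX hf _
  set Y : ℕ → Ω → ℝ := fun m ω => ftil (m * τ) ω - c with hYdef
  have hY : ∀ m, Measurable[𝒢 (m + 1)] (Y m) := fun m =>
    hmeas.comp (measurable_pathSigma_obs X ftil (Nat.lt_succ_self (m * τ)))
  have htail := measure_inter_abs_sum_gt_le (Pr := Pr) h𝒢 h𝒢le hY (ν := ν)
    (η := 1 / (3 * N) + ε) (v := v) (a := M * t) (by positivity) hvpos.le (by positivity)
    ((integrable_map_measure (by fun_prop) hmeas.aemeasurable).2 hνsub)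
    ((integrable_map_measure (by fun_prop) hmeas.aemeasurable).2 hνsub2)
    (by
      rw [integral_map hmeas.aemeasurable (by fun_prop),
        integral_sub hν₁ (integrable_const _), hνmean]
      simp)
    (by
      rw [integral_map hmeas.aemeasurable (by fun_prop)]
      exact integral_mixture_sub_sq_le hπ0 hπ1 hF hD1 hD2 hmean hvar)
    (by
      intro m G S g hG hS hg hg1
      have hS' : Measurable[𝒢 m] fun ω => S ω - c := hmeas.comp hS
      have := hcyl.setLIntegral_subsample_le h0 h1 hπ0 hπ1 hε0 (by linarith) hX hf hτ1
        (by positivity) hmix m hG hS' hg hg1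
      convert this using 4 with ω ω
      · simp only [hYdef]; ring_nf
      · rw [lintegral_map (by fun_prop) hmeas]
        simp only [add_sub_assoc, sub_add_eq_add_sub]
        rfl) M
  set b : ℕ → Set Ω := fun i => {ω | M * t < |∑ j ∈ Finset.range M, Y (i * M + j) ω|} with hbdef
  have hb : ∀ i, MeasurableSet[𝒢 ((i + 1) * M)] (b i) := by
    intro i
    have hsum : Measurable[𝒢 ((i + 1) * M)]
        fun ω => ∑ j ∈ Finset.range M, Y (i * M + j) ω := by
      refine Finset.measurable_sum _ fun j hj => (hY (i * M + j)).mono (h𝒢 ?_) le_rfl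
      have := Finset.mem_range.1 hj
      rw [add_mul]; omega
    exact hsum (measurableSet_lt measurable_const measurable_id.abs)
  have hbp : ∀ i G, MeasurableSet[𝒢 (i * M)] G →
      Pr (G ∩ b i) ≤ Pr G * ENNReal.ofReal (1 / 3) ^ 2 := by
    intro i G hG
    have h2 := htail (i * M) G (fun _ => 0) hG measurable_const
    simp only [zero_add] at h2
    refine h2.trans ?_
    calc _ ≤ ∫⁻ _ in G, ENNReal.ofReal (1 / 3) ^ 2 ∂Pr := by
          refine lintegral_mono fun ω => (min_le_right _ _).trans ?_
          rw [← ENNReal.ofReal_pow (by norm_num)]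
          refine ENNReal.ofReal_le_ofReal ?_
          have : ((0 : ℝ) ^ 2 + M * v) / (M * t) ^ 2 = 1 / 72 := by
            rw [mul_pow, ht2]; field_simp; ring
          rw [this]
          exact hp.trans (by norm_num)
      _ = _ := by rw [setLIntegral_const, mul_comm]
  classical
  have hhalf := measure_half_events_le (Pr := Pr) (ℋ := fun i => 𝒢 (i * M))
    (h𝒢.comp fun i j hij => Nat.mul_le_mul_right M hij) hb
    (ENNReal.ofReal_le_one.2 (by norm_num)) hbp L
  have hbad : Pr {ω | L ≤ 2 * ((Finset.range L).filter fun i => ω ∈ b i).card} ≤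
      ENNReal.ofReal δ := by
    refine hhalf.trans ?_
    have : (2 : ENNReal) * ENNReal.ofReal (1 / 3) = ENNReal.ofReal (2 / 3) := by
      rw [← ENNReal.ofReal_ofNat 2, ← ENNReal.ofReal_mul (by norm_num)]
      norm_num
    rw [this, ← ENNReal.ofReal_pow (by norm_num)]
    exact ENNReal.ofReal_le_ofReal hδL
  have hA : 0 ≤ A := mul_nonneg (by positivity) (by linarith [(log_div_bounds hδ0 hδ1 hN).1])
  have ht : t ≤ 450 * max ψ ρ * (Real.sqrt ε + Real.sqrt A) := by
    have hm : 0 < max ψ ρ := hψ.trans_le (le_max_left _ _)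
    refine Real.sqrt_le_iff.2 ⟨by positivity, ?_⟩
    have hv2 : v ≤ 2 * max ψ ρ ^ 2 := by
      have e1 := pow_le_pow_left₀ hψ.le (le_max_left ψ ρ) 2
      have e2 := pow_le_pow_left₀ hρ.le (le_max_right ψ ρ) 2
      linarith
    have hs : ε + A ≤ (Real.sqrt ε + Real.sqrt A) ^ 2 := by
      nlinarith [Real.sq_sqrt hε0, Real.sq_sqrt hA, Real.sqrt_nonneg ε, Real.sqrt_nonneg A,
        mul_nonneg (Real.sqrt_nonneg ε) (Real.sqrt_nonneg A)]
    calc 72 * v / M = 72 * v * (1 / M) := by ring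
      _ ≤ 72 * (2 * max ψ ρ ^ 2) * (1400 * (ε + A)) := by gcongr
      _ = 201600 * max ψ ρ ^ 2 * (ε + A) := by ring
      _ ≤ 202500 * max ψ ρ ^ 2 * (Real.sqrt ε + Real.sqrt A) ^ 2 := by gcongr; norm_num
      _ = _ := by ring
  have hgood : {ω | L ≤ 2 * ((Finset.range L).filter fun i => ω ∈ b i).card}ᶜ ⊆
      {ω | |muhat ω - c| ≤ 450 * max ψ ρ * (Real.sqrt ε + Real.sqrt A)} := by
    intro ω hω
    refine ((hmed ω).abs_sub_le ?_).trans ht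
    have hlt : 2 * ((Finset.range L).filter fun i => ω ∈ b i).card < L := not_le.1 hω
    convert hlt using 4 with i
    rw [subsampledBucketMean_sub hM1, abs_div, abs_of_pos hMpos, lt_div_iff₀ hMpos, mul_comm]
    rfl
  refine le_trans ?_ (measure_mono hgood)
  have hone : (1 : ENNReal) ≤
      Pr {ω | L ≤ 2 * ((Finset.range L).filter fun i => ω ∈ b i).card} +
        Pr {ω | L ≤ 2 * ((Finset.range L).filter fun i => ω ∈ b i).card}ᶜ := by
    rw [← measure_univ (μ := Pr), ← Set.union_compl_self]
    exact measure_union_le _ _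
  rw [ENNReal.ofReal_sub _ hδ0.le, ENNReal.ofReal_one, tsub_le_iff_left]
  exact hone.trans (by gcongr)
end

section
/- (Steady-state TD direction points toward the fixed point.) Let P ∈ ℝ^{m×m} be row-stochastic, let π be a probability vector with πᵀP = πᵀ and π(s) > 0 for all s, let D = diag(π), let Φ ∈ ℝ^{m×K} have full column rank, let γ ∈ (0,1), and set Ā = ΦᵀD(γP − I)Φ. Let ω > 0 be the smallest eigenvalue of Σ = ΦᵀDΦ. Then for every b̄ ∈ ℝ^K, every θ* ∈ ℝ^K with Āθ* + b̄ = 0, and every θ ∈ ℝ^K, one has ⟨θ* − θ, Āθ + b̄⟩ ≥ ω(1−γ) ‖θ* − θ‖₂². Equivalently, ⟨x, Āx⟩ ≤ −ω(1−γ)‖x‖₂² for all x ∈ ℝ^K. -/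
open Matrix

theorem Matrix.IsHermitian.iInf_eigenvalues_mul_dotProduct_le {n : Type*} [Fintype n]
    [DecidableEq n] {A : Matrix n n ℝ} (hA : A.IsHermitian) (x : n → ℝ) :
    (⨅ i, hA.eigenvalues i) * (x ⬝ᵥ x) ≤ x ⬝ᵥ A *ᵥ x := by
  let U : Matrix n n ℝ := hA.eigenvectorUnitary.1
  have hUU : U * Uᵀ = 1 := by
    have h := Unitary.coe_mul_star_self hA.eigenvectorUnitary
    rwa [Unitary.coe_star, Matrix.star_eq_conjTranspose,
      Matrix.conjTranspose_eq_transpose_of_trivial] at h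
  have hspec : A = U * diagonal hA.eigenvalues * Uᵀ := by
    have h := hA.spectral_theorem
    rw [Unitary.conjStarAlgAut_apply, Matrix.star_eq_conjTranspose,
      Matrix.conjTranspose_eq_transpose_of_trivial] at h
    exact h
  have hquad : ∀ B : Matrix n n ℝ,
      x ⬝ᵥ (U * B * Uᵀ) *ᵥ x = (Uᵀ *ᵥ x) ⬝ᵥ B *ᵥ (Uᵀ *ᵥ x) := by
    intro B
    rw [← mulVec_mulVec, ← mulVec_mulVec, dotProduct_mulVec, mulVec_transpose]
  have hxx : x ⬝ᵥ x = (Uᵀ *ᵥ x) ⬝ᵥ (Uᵀ *ᵥ x) := by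
    simpa [hUU] using hquad 1
  have hxAx : x ⬝ᵥ A *ᵥ x = (Uᵀ *ᵥ x) ⬝ᵥ diagonal hA.eigenvalues *ᵥ (Uᵀ *ᵥ x) := by
    conv_lhs => rw [hspec]
    exact hquad _
  rw [hxx, hxAx]
  simp only [dotProduct, mulVec_diagonal, Finset.mul_sum]
  refine Finset.sum_le_sum fun i _ => ?_
  have hi : (⨅ i, hA.eigenvalues i) ≤ hA.eigenvalues i :=
    ciInf_le (Set.finite_range _).bddBelow i
  nlinarith [mul_le_mul_of_nonneg_right hi (mul_self_nonneg ((Uᵀ *ᵥ x) i))]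

/-- A row-stochastic matrix with stationary weights `π` does not increase the quadratic form
weighted by `π`. -/
theorem dotProduct_diagonal_mulVec_stochastic_le {n : Type*} [Fintype n] [DecidableEq n]
    {P : Matrix n n ℝ} (hPnn : ∀ i j, 0 ≤ P i j) (hProw : ∀ i, ∑ j, P i j = 1)
    {π : n → ℝ} (hπ : ∀ s, 0 ≤ π s) (hπstat : π ᵥ* P = π) (v : n → ℝ) :
    v ⬝ᵥ diagonal π *ᵥ (P *ᵥ v) ≤ v ⬝ᵥ diagonal π *ᵥ v := by
  have hrow : ∑ i, ∑ j, π i * P i j * v i ^ 2 = ∑ i, π i * v i ^ 2 := by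
    refine Finset.sum_congr rfl fun i _ => ?_
    rw [← Finset.sum_mul, ← Finset.mul_sum, hProw, mul_one]
  have hcol : ∑ i, ∑ j, π i * P i j * v j ^ 2 = ∑ j, π j * v j ^ 2 := by
    rw [Finset.sum_comm]
    refine Finset.sum_congr rfl fun j _ => ?_
    rw [← Finset.sum_mul]
    exact congrArg (· * v j ^ 2) (congrFun hπstat j)
  have hlhs : v ⬝ᵥ diagonal π *ᵥ (P *ᵥ v) = ∑ i, ∑ j, π i * P i j * (v i * v j) := by
    simp only [dotProduct, mulVec_diagonal]
    refine Finset.sum_congr rfl fun i _ => ?_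
    simp only [mulVec, dotProduct, Finset.mul_sum]
    exact Finset.sum_congr rfl fun j _ => by ring
  have hrhs : v ⬝ᵥ diagonal π *ᵥ v = ∑ i, π i * v i ^ 2 := by
    simp only [dotProduct, mulVec_diagonal]
    exact Finset.sum_congr rfl fun i _ => by ring
  have hamgm : 2 * ∑ i, ∑ j, π i * P i j * (v i * v j) ≤
      ∑ i, ∑ j, π i * P i j * v i ^ 2 + ∑ i, ∑ j, π i * P i j * v j ^ 2 := by
    simp only [Finset.mul_sum, ← Finset.sum_add_distrib]
    refine Finset.sum_le_sum fun i _ => Finset.sum_le_sum fun j _ => ?_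
    nlinarith [mul_nonneg (mul_nonneg (hπ i) (hPnn i j)) (sq_nonneg (v i - v j))]
  rw [hlhs, hrhs]
  linarith

/-- **Steady-state TD direction points toward the fixed point.**
Let `P` be row-stochastic with stationary distribution `π > 0`, `D = diag(π)`,
`Φ` of full column rank, `γ ∈ (0,1)`, `Ā = ΦᵀD(γP − I)Φ`, and let `ω > 0` be the
smallest eigenvalue of `Σ = ΦᵀDΦ`. Then for every `b̄`, every `θ*` with
`Āθ* + b̄ = 0`, and every `θ`, one has
`⟨θ* − θ, Āθ + b̄⟩ ≥ ω(1−γ)‖θ* − θ‖₂²`; equivalently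
`⟨x, Āx⟩ ≤ −ω(1−γ)‖x‖₂²` for all `x` (squared norms written as dot products). -/
theorem steady_state_td_direction
    (m K : ℕ) (hK : 0 < K)
    (P : Matrix (Fin m) (Fin m) ℝ)
    (hPnn : ∀ i j, 0 ≤ P i j) (hProw : ∀ i, ∑ j, P i j = 1)
    (π : Fin m → ℝ) (hπpos : ∀ s, 0 < π s) (hπsum : ∑ s, π s = 1)
    (hπstat : Matrix.vecMul π P = π)
    (Φ : Matrix (Fin m) (Fin K) ℝ)
    (hΦ : Function.Injective Φ.mulVec)  -- full column rank
    (γ : ℝ) (hγ0 : 0 < γ) (hγ1 : γ < 1)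
    (hSig : (Φᵀ * Matrix.diagonal π * Φ).IsHermitian)
    (ω : ℝ) (hω : ω = ⨅ i, hSig.eigenvalues i) (hωpos : 0 < ω)
    (Abar : Matrix (Fin K) (Fin K) ℝ)
    (hAbar : Abar = Φᵀ * Matrix.diagonal π * (γ • P - 1) * Φ) :
    (∀ bbar θstar θ : Fin K → ℝ, Abar.mulVec θstar + bbar = 0 →
      ω * (1 - γ) * ((θstar - θ) ⬝ᵥ (θstar - θ)) ≤
        (θstar - θ) ⬝ᵥ (Abar.mulVec θ + bbar)) ∧
    (∀ x : Fin K → ℝ, x ⬝ᵥ Abar.mulVec x ≤ -(ω * (1 - γ) * (x ⬝ᵥ x))) := by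
  have hneg : ∀ x : Fin K → ℝ, x ⬝ᵥ Abar.mulVec x ≤ -(ω * (1 - γ) * (x ⬝ᵥ x)) := by
    intro x
    have hquad : ∀ v : Fin m → ℝ,
        x ⬝ᵥ Φᵀ *ᵥ (diagonal π *ᵥ v) = (Φ *ᵥ x) ⬝ᵥ diagonal π *ᵥ v := by
      intro v
      rw [dotProduct_mulVec, vecMul_transpose]
    have hSigma : ω * (x ⬝ᵥ x) ≤ (Φ *ᵥ x) ⬝ᵥ diagonal π *ᵥ (Φ *ᵥ x) := by
      have h := hSig.iInf_eigenvalues_mul_dotProduct_le x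
      rwa [← hω, ← mulVec_mulVec, ← mulVec_mulVec, hquad] at h
    have hstat := dotProduct_diagonal_mulVec_stochastic_le hPnn hProw (fun s => (hπpos s).le)
      hπstat (Φ *ᵥ x)
    have hexpand : x ⬝ᵥ Abar *ᵥ x =
        γ * ((Φ *ᵥ x) ⬝ᵥ diagonal π *ᵥ (P *ᵥ (Φ *ᵥ x))) -
          (Φ *ᵥ x) ⬝ᵥ diagonal π *ᵥ (Φ *ᵥ x) := by
      rw [hAbar, ← mulVec_mulVec, ← mulVec_mulVec, ← mulVec_mulVec, hquad, sub_mulVec,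
        one_mulVec, smul_mulVec, mulVec_sub, mulVec_smul, dotProduct_sub, dotProduct_smul,
        smul_eq_mul]
    rw [hexpand]
    nlinarith [mul_le_mul_of_nonneg_left hstat hγ0.le,
      mul_le_mul_of_nonneg_left hSigma (sub_nonneg.2 hγ1.le)]
  refine ⟨fun bbar θstar θ hfix => ?_, hneg⟩
  have hdir : Abar.mulVec θ + bbar = -(Abar *ᵥ (θstar - θ)) := by
    rw [eq_neg_of_add_eq_zero_right hfix, mulVec_sub]
    abel
  rw [hdir, dotProduct_neg]
  linarith [hneg (θstar - θ)]
end
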